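/- arXiv:2403.09342 — 3 statements merged into one kernel-verified Lean document; each statement's English description precedes it below -/
import Mathlib

section
/- For any pure two-qubit state ρ = |ψ⟩⟨ψ| on ℂ²⊗ℂ², the geometric quantum discord equals twice the squared negativity: D_g(|ψ⟩⟨ψ|) = 2·N_{|ψ⟩⟨ψ|}², where N_ρ = (‖ρ^{T₂}‖₁ − 1)/2, ρ^{T₂} is the partial transpose of ρ on the second factor, and ‖·‖₁ is the trace norm. -/
open Matrix Finset
open scoped Kronecker ComplexOrder

noncomputable section

/-- A quantum state: a positive semidefinite (hence Hermitian) matrix of trace 1. -/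
def IsState {n : Type*} [Fintype n] (ρ : Matrix n n ℂ) : Prop :=
  ρ.PosSemidef ∧ ρ.trace = 1

/-- The pure state (rank-one projection) associated with a vector `ψ`. -/
def pureState {n : Type*} (ψ : n → ℂ) : Matrix n n ℂ :=
  Matrix.vecMulVec ψ (star ψ)

/-- A Bloch basis for `d × d` complex matrices: a family of nonzero traceless Hermitian
matrices with `tr[Υ k * Υ m] = 2 δ_{km}`. -/
def IsBlochBasis (d : ℕ) (Υ : Fin (d ^ 2 - 1) → Matrix (Fin d) (Fin d) ℂ) : Prop :=
  (∀ k, Υ k ≠ 0) ∧ (∀ k, (Υ k).IsHermitian) ∧ (∀ k, (Υ k).trace = 0) ∧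
    (∀ k m, (Υ k * Υ m).trace = if k = m then 2 else 0)

/-- The Bloch vector of a state `ρ` on `ℂ^d` relative to a Bloch basis `Υ`. -/
def blochVector {d : ℕ} (ρ : Matrix (Fin d) (Fin d) ℂ)
    (Υ : Fin (d ^ 2 - 1) → Matrix (Fin d) (Fin d) ℂ) : Fin (d ^ 2 - 1) → ℝ :=
  fun k => Real.sqrt ((d : ℝ) / (2 * ((d : ℝ) - 1))) * ((ρ * Υ k).trace).re

/-- Partial trace over the first tensor factor. -/
def ptrace1 {d₁ d₂ : ℕ} (ρ : Matrix (Fin d₁ × Fin d₂) (Fin d₁ × Fin d₂) ℂ) :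
    Matrix (Fin d₂) (Fin d₂) ℂ :=
  Matrix.of fun j j' => ∑ i, ρ (i, j) (i, j')

/-- Partial trace over the second tensor factor. -/
def ptrace2 {d₁ d₂ : ℕ} (ρ : Matrix (Fin d₁ × Fin d₂) (Fin d₁ × Fin d₂) ℂ) :
    Matrix (Fin d₁) (Fin d₁) ℂ :=
  Matrix.of fun i i' => ∑ j, ρ (i, j) (i', j)

/-- Partial transpose with respect to the second tensor factor. -/
def ptranspose2 {d₁ d₂ : ℕ} (ρ : Matrix (Fin d₁ × Fin d₂) (Fin d₁ × Fin d₂) ℂ) :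
    Matrix (Fin d₁ × Fin d₂) (Fin d₁ × Fin d₂) ℂ :=
  Matrix.of fun p q => ρ (p.1, q.2) (q.1, p.2)

/-- The correlation matrix of a two-qudit state, `T^{ij} = tr[ρ (Υ₁ i ⊗ Υ₂ j)]`. -/
def corrMatrix {d₁ d₂ : ℕ} (ρ : Matrix (Fin d₁ × Fin d₂) (Fin d₁ × Fin d₂) ℂ)
    (Υ₁ : Fin (d₁ ^ 2 - 1) → Matrix (Fin d₁) (Fin d₁) ℂ)
    (Υ₂ : Fin (d₂ ^ 2 - 1) → Matrix (Fin d₂) (Fin d₂) ℂ) :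
    Matrix (Fin (d₁ ^ 2 - 1)) (Fin (d₂ ^ 2 - 1)) ℝ :=
  Matrix.of fun i j => ((ρ * (Υ₁ i ⊗ₖ Υ₂ j)).trace).re

/-- A quantum-classical state `χ = Σ_k α_k σ_k ⊗ |k⟩⟨k|`. -/
def IsQCState {d₁ d₂ : ℕ} (χ : Matrix (Fin d₁ × Fin d₂) (Fin d₁ × Fin d₂) ℂ) : Prop :=
  ∃ (α : Fin d₂ → ℝ) (σ : Fin d₂ → Matrix (Fin d₁) (Fin d₁) ℂ) (e : Fin d₂ → Fin d₂ → ℂ),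
    (∀ k, 0 ≤ α k) ∧ (∑ k, α k = 1) ∧ (∀ k, IsState (σ k)) ∧
    (∀ k l, ∑ i, star (e k i) * e l i = if k = l then (1 : ℂ) else 0) ∧
    χ = ∑ k, (α k : ℂ) • (σ k ⊗ₖ pureState (e k))

/-- The geometric quantum discord (with the Hilbert–Schmidt distance):
`D_g(ρ) = min over quantum-classical χ of tr[(ρ - χ)²]`. -/
def Dg {d₁ d₂ : ℕ} (ρ : Matrix (Fin d₁ × Fin d₂) (Fin d₁ × Fin d₂) ℂ) : ℝ :=
  sInf {x : ℝ | ∃ χ, IsQCState χ ∧ x = (((ρ - χ) * (ρ - χ)).trace).re}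

/-- `η` lists the eigenvalues of the real matrix `G` in decreasing order with algebraic
multiplicities: `η` is antitone and the characteristic polynomial of `G` splits as
`∏ (X - η n)`. -/
def IsEigList {N : ℕ} (G : Matrix (Fin N) (Fin N) ℝ) (η : Fin N → ℝ) : Prop :=
  Antitone η ∧ G.charpoly = ∏ n, (Polynomial.X - Polynomial.C (η n))

/-- A simplex frame in `ℝ^N`: `d` unit vectors summing to zero with pairwise scalar
products `-1/(d-1)`. -/
def IsSimplexFrame {N : ℕ} (d : ℕ) (y : Fin d → Fin N → ℝ) : Prop :=
  (∀ k, ∑ i, y k i ^ 2 = 1) ∧ (∀ i, ∑ k, y k i = 0) ∧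
    (∀ j k, j ≠ k → ∑ i, y j i * y k i = -1 / ((d : ℝ) - 1))

/-- The operator `Π_{Ω_y} = ((d-1)/d) Σ_k y_k y_kᵀ` associated with a simplex frame. -/
def simplexProj {N : ℕ} (d : ℕ) (y : Fin d → Fin N → ℝ) : Matrix (Fin N) (Fin N) ℝ :=
  (((d : ℝ) - 1) / d) • ∑ k, Matrix.vecMulVec (y k) (y k)

/-- The matrix `G(ρ) = ((d₂-1)/(d₁ d₂)) r₂ r₂ᵀ + (1/4) T_ρᵀ T_ρ`. -/
def Gmat {d₁ d₂ : ℕ} (ρ : Matrix (Fin d₁ × Fin d₂) (Fin d₁ × Fin d₂) ℂ)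
    (Υ₁ : Fin (d₁ ^ 2 - 1) → Matrix (Fin d₁) (Fin d₁) ℂ)
    (Υ₂ : Fin (d₂ ^ 2 - 1) → Matrix (Fin d₂) (Fin d₂) ℂ) :
    Matrix (Fin (d₂ ^ 2 - 1)) (Fin (d₂ ^ 2 - 1)) ℝ :=
  (((d₂ : ℝ) - 1) / (d₁ * d₂)) •
      Matrix.vecMulVec (blochVector (ptrace1 ρ) Υ₂) (blochVector (ptrace1 ρ) Υ₂)
    + (4 : ℝ)⁻¹ • ((corrMatrix ρ Υ₁ Υ₂)ᵀ * corrMatrix ρ Υ₁ Υ₂)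

/-- The trace norm (sum of singular values) of a complex square matrix. -/
def traceNorm {n : Type*} [Fintype n] [DecidableEq n] (X : Matrix n n ℂ) : ℝ :=
  ∑ i, Real.sqrt ((Matrix.posSemidef_conjTranspose_mul_self X).1.eigenvalues i)

/-- The negativity `N_ρ = (‖ρ^{T₂}‖₁ - 1)/2`. -/
def negativity {d₁ d₂ : ℕ} (ρ : Matrix (Fin d₁ × Fin d₂) (Fin d₁ × Fin d₂) ℂ) : ℝ :=
  (traceNorm (ptranspose2 ρ) - 1) / 2

/-- The concurrence of a pure two-qudit state, `C = √(2 (1 - tr[ρ₁²]))`, `ρ₁ = tr₂ ρ`. -/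
def concurrence {d₁ d₂ : ℕ} (ρ : Matrix (Fin d₁ × Fin d₂) (Fin d₁ × Fin d₂) ℂ) : ℝ :=
  Real.sqrt (2 * (1 - ((ptrace2 ρ * ptrace2 ρ).trace).re))


lemma traceNorm_of_sqrt {n : Type*} [Fintype n] [DecidableEq n] (X S : Matrix n n ℂ)
    (hS : S.PosSemidef) (h : S * S = Xᴴ * X) : traceNorm X = S.trace.re := by
  have hM := (Matrix.posSemidef_conjTranspose_mul_self X).1
  have hc : (Xᴴ * X).charpoly =
      ∏ i, (Polynomial.X - Polynomial.C (((hS.1.eigenvalues i) ^ 2 : ℝ) : ℂ)) := by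
    rw [← h]
    conv_lhs => rw [hS.1.spectral_theorem, ← map_mul, Unitary.conjStarAlgAut_apply,
      Matrix.charpoly_mul_comm, ← mul_assoc]
    simp [Matrix.charpoly_diagonal, pow_two]
  have hr := hM.roots_charpoly_eq_eigenvalues
  rw [hc, Polynomial.roots_prod] at hr
  · simp only [Polynomial.roots_X_sub_C, Multiset.bind_singleton] at hr
    have h2 := congrArg (fun m => (m.map (fun z : ℂ => Real.sqrt z.re)).sum) hr
    simp only [Multiset.map_map, Function.comp_def] at h2
    rw [hS.1.trace_eq_sum_eigenvalues]
    unfold traceNorm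
    simp only [Finset.sum, Complex.coe_algebraMap, Complex.ofReal_re] at h2 ⊢
    have h3 : ∀ i, Real.sqrt (hS.1.eigenvalues i ^ 2) = hS.1.eigenvalues i :=
      fun i => Real.sqrt_sq (hS.eigenvalues_nonneg i)
    simp only [h3] at h2
    rw [← h2]
    change _ = Complex.re (∑ i, ((hS.1.eigenvalues i : ℝ) : ℂ))
    rw [Complex.re_sum]
    rfl
  · exact Finset.prod_ne_zero_iff.mpr fun i _ => Polynomial.X_sub_C_ne_zero _

lemma sq_add_det (P : Matrix (Fin 2) (Fin 2) ℂ) (c : ℝ) (ht : P.trace = 1)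
    (hd : P.det = (c : ℂ) ^ 2) :
    (P + (c : ℂ) • 1) * (P + (c : ℂ) • 1) = (1 + 2 * (c : ℂ)) • P := by
  rw [Matrix.trace_fin_two] at ht
  rw [Matrix.det_fin_two] at hd
  have h1 : P 1 1 = 1 - P 0 0 := by linear_combination ht
  rw [h1] at hd
  ext i j
  fin_cases i <;> fin_cases j <;> simp [Matrix.mul_apply, Fin.sum_univ_two, h1]
  · linear_combination -hd
  · ring
  · ring
  · linear_combination -hd

/-- coefficient matrix -/
def cm (ψ : Fin 2 × Fin 2 → ℂ) : Matrix (Fin 2) (Fin 2) ℂ := Matrix.of fun i j => ψ (i, j)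

lemma negativity_pure (ψ : Fin 2 × Fin 2 → ℂ) (hψ : ∑ i, Complex.normSq (ψ i) = 1) :
    negativity (pureState ψ) = ‖(cm ψ).det‖ := by
  set A := cm ψ with hA
  set c := ‖A.det‖ with hc
  have hc0 : 0 ≤ c := norm_nonneg _
  have ht : (A * Aᴴ).trace = 1 := by
    have : (∑ i, (Complex.normSq (ψ i) : ℂ)) = 1 := by exact_mod_cast hψ
    rw [← this]
    simp [Matrix.trace, Matrix.mul_apply, Fintype.sum_prod_type, hA, cm, Complex.mul_conj]
  have ht' : (Aᴴ * A).trace = 1 := by rw [Matrix.trace_mul_comm, ht]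
  have hd : (A * Aᴴ).det = (c : ℂ) ^ 2 := by
    rw [Matrix.det_mul, Matrix.det_conjTranspose, hc]
    exact Complex.mul_conj' _
  have hd' : (Aᴴ * A).det = (c : ℂ) ^ 2 := by rw [Matrix.det_mul_comm, hd]
  have hX : (ptranspose2 (pureState ψ))ᴴ * ptranspose2 (pureState ψ)
      = (A * Aᴴ) ⊗ₖ (Aᴴ * A) := by
    ext ⟨i, j⟩ ⟨k, l⟩
    simp [Matrix.mul_apply, Fintype.sum_prod_type, hA, cm, ptranspose2, pureState,
      Matrix.vecMulVec_apply, Fin.sum_univ_two]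
    ring
  have hne : (1 + 2 * (c : ℂ)) ≠ 0 := by
    have : (1 + 2 * c) ≠ 0 := by positivity
    exact_mod_cast this
  have hcp : ∀ P : Matrix (Fin 2) (Fin 2) ℂ, P.PosSemidef → (P + (c : ℂ) • 1).PosSemidef := by
    intro P hP
    exact hP.add (Matrix.PosSemidef.one.smul (by exact_mod_cast hc0))
  have key := traceNorm_of_sqrt (ptranspose2 (pureState ψ))
    (((1 + 2 * c : ℝ) : ℂ)⁻¹ • ((A * Aᴴ + (c : ℂ) • 1) ⊗ₖ (Aᴴ * A + (c : ℂ) • 1)))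
    (by
      refine Matrix.PosSemidef.smul (Matrix.PosSemidef.kronecker
        (hcp _ (Matrix.posSemidef_self_mul_conjTranspose A))
        (hcp _ (Matrix.posSemidef_conjTranspose_mul_self A))) ?_
      rw [← Complex.ofReal_inv]
      exact_mod_cast (by positivity : (0:ℝ) ≤ (1 + 2 * c)⁻¹))
    (by
      rw [hX, Matrix.smul_mul, Matrix.mul_smul, ← Matrix.mul_kronecker_mul,
        sq_add_det _ c ht hd, sq_add_det _ c ht' hd', Matrix.smul_kronecker,
        Matrix.kronecker_smul]
      push_cast
      simp only [smul_smul]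
      field_simp
      simp)
  have ht2 : (((1 + 2 * c : ℝ) : ℂ)⁻¹ •
      ((A * Aᴴ + (c : ℂ) • 1) ⊗ₖ (Aᴴ * A + (c : ℂ) • 1))).trace = ((1 + 2 * c : ℝ) : ℂ) := by
    rw [Matrix.trace_smul, Matrix.trace_kronecker]
    simp only [Matrix.trace_add, ht, ht', Matrix.trace_smul, Matrix.trace_one]
    push_cast
    simp only [smul_eq_mul, Fintype.card_fin]
    field_simp
    push_cast
    ring
  rw [ht2, Complex.ofReal_re] at key
  rw [negativity, key]
  ring

lemma trace_sq_herm {n : Type*} [Fintype n] (H : Matrix n n ℂ) (hH : H.IsHermitian) :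
    ((H * H).trace).re = ∑ i, ∑ j, Complex.normSq (H i j) := by
  have : (H * H).trace = ∑ i, ∑ j, (Complex.normSq (H i j) : ℂ) := by
    simp only [Matrix.trace, Matrix.diag, Matrix.mul_apply]
    refine Finset.sum_congr rfl fun i _ => Finset.sum_congr rfl fun j _ => ?_
    rw [← hH.apply i j, ← Complex.mul_conj, mul_comm]
    simp [mul_comm]
  rw [this]
  simp

/-- unitary whose columns are the basis vectors -/
def um (e : Fin 2 → Fin 2 → ℂ) : Matrix (Fin 2) (Fin 2) ℂ := Matrix.of fun j k => e k j

/-- components of the state vector in the basis -/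
def vcomp (ψ : Fin 2 × Fin 2 → ℂ) (e : Fin 2 → Fin 2 → ℂ) (p : Fin 2 × Fin 2) : ℂ :=
  ∑ j, star (e p.2 j) * ψ (p.1, j)

/-- difference in the rotated basis -/
def dm (φ : Fin 2 × Fin 2 → ℂ) (τ : Fin 2 → Matrix (Fin 2) (Fin 2) ℂ) :
    Matrix (Fin 2 × Fin 2) (Fin 2 × Fin 2) ℂ :=
  Matrix.of fun p q => φ p * star (φ q) - if p.2 = q.2 then τ p.2 p.1 q.1 else 0

lemma um_unit (e : Fin 2 → Fin 2 → ℂ)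
    (he : ∀ k l, ∑ i, star (e k i) * e l i = if k = l then (1 : ℂ) else 0) :
    (um e)ᴴ * um e = 1 := by
  ext k l
  rw [Matrix.one_apply, ← he k l]
  simp [Matrix.mul_apply, um]

lemma trace_rot (ψ : Fin 2 × Fin 2 → ℂ) (e : Fin 2 → Fin 2 → ℂ)
    (τ : Fin 2 → Matrix (Fin 2) (Fin 2) ℂ)
    (he : ∀ k l, ∑ i, star (e k i) * e l i = if k = l then (1 : ℂ) else 0) :
    ((pureState ψ - ∑ k, τ k ⊗ₖ pureState (e k)) *
      (pureState ψ - ∑ k, τ k ⊗ₖ pureState (e k))).trace =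
    (dm (vcomp ψ e) τ * dm (vcomp ψ e) τ).trace := by
  set D := pureState ψ - ∑ k, τ k ⊗ₖ pureState (e k) with hD
  set V : Matrix (Fin 2 × Fin 2) (Fin 2 × Fin 2) ℂ := (1 : Matrix (Fin 2) (Fin 2) ℂ) ⊗ₖ um e with hV
  have hu := um_unit e he
  have hV1 : Vᴴ * V = 1 := by
    rw [hV, Matrix.conjTranspose_kronecker, ← Matrix.mul_kronecker_mul, hu]
    simp
  have hV2 : V * Vᴴ = 1 := mul_eq_one_comm.mp hV1
  have h1 : Vᴴ * pureState ψ * V = pureState (vcomp ψ e) := by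
    have hv : vcomp ψ e = Vᴴ *ᵥ ψ := by
      ext ⟨i, k⟩
      simp [vcomp, hV, Matrix.mulVec, dotProduct, Fintype.sum_prod_type, Matrix.one_apply, um,
        apply_ite]
    rw [hv, pureState, pureState, Matrix.mul_vecMulVec, Matrix.vecMulVec_mul, Matrix.star_mulVec,
      Matrix.conjTranspose_conjTranspose]
  have h2 : ∀ k, Vᴴ * (τ k ⊗ₖ pureState (e k)) * V = τ k ⊗ₖ Matrix.single k k 1 := by
    intro k
    rw [hV, Matrix.conjTranspose_kronecker, ← Matrix.mul_kronecker_mul,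
      ← Matrix.mul_kronecker_mul]
    simp only [Matrix.conjTranspose_one, one_mul, mul_one]
    congr 1
    have hv : (um e)ᴴ *ᵥ e k = Pi.single k 1 := by
      ext l
      have := he l k
      simpa [Matrix.mulVec, dotProduct, um, Pi.single_apply] using this
    have hv' : star (e k) ᵥ* (um e) = star ((um e)ᴴ *ᵥ e k) := by
      rw [Matrix.star_mulVec, Matrix.conjTranspose_conjTranspose]
    rw [pureState, Matrix.mul_vecMulVec, Matrix.vecMulVec_mul, hv', hv]
    ext a b
    fin_cases k <;> fin_cases a <;> fin_cases b <;> simp [Matrix.vecMulVec_apply]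
  have h3 : Vᴴ * D * V = dm (vcomp ψ e) τ := by
    rw [hD, Matrix.mul_sub, Matrix.sub_mul, h1, Matrix.mul_sum, Matrix.sum_mul]
    simp only [h2]
    ext ⟨i, k⟩ ⟨j, l⟩
    simp only [dm, pureState, Matrix.sub_apply, Matrix.vecMulVec_apply, Matrix.of_apply,
      Fin.sum_univ_two, Matrix.add_apply, Matrix.kroneckerMap_apply, Pi.star_apply]
    congr 1
    fin_cases k <;> fin_cases l <;> simp
  rw [← h3]
  have : Vᴴ * D * V * (Vᴴ * D * V) = Vᴴ * (D * D * V) := by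
    calc _ = Vᴴ * D * (V * Vᴴ) * D * V := by simp only [Matrix.mul_assoc]
      _ = _ := by rw [hV2]; simp only [Matrix.mul_assoc, Matrix.one_mul]
  rw [this, Matrix.trace_mul_comm Vᴴ, Matrix.mul_assoc (D * D), hV2, Matrix.mul_one]

lemma det_comp (ψ : Fin 2 × Fin 2 → ℂ) (e : Fin 2 → Fin 2 → ℂ)
    (he : ∀ k l, ∑ i, star (e k i) * e l i = if k = l then (1 : ℂ) else 0) :
    Complex.normSq (cm (vcomp ψ e)).det = ‖(cm ψ).det‖ ^ 2 := by
  have h : cm (vcomp ψ e) = cm ψ * (um e).map star := by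
    ext i k
    simp [cm, vcomp, um, Matrix.mul_apply, mul_comm]
  have hu := congrArg Matrix.det (um_unit e he)
  rw [Matrix.det_mul, Matrix.det_conjTranspose, Matrix.det_one] at hu
  have h2 : Complex.normSq (um e).det = 1 := by
    have h3 := Complex.normSq_eq_conj_mul_self (z := (um e).det)
    rw [show (starRingEnd ℂ) (um e).det * (um e).det = 1 from hu] at h3
    exact_mod_cast h3
  have h4 : ((um e).map star).det = star (um e).det := by
    rw [← Matrix.det_conjTranspose, ← Matrix.det_transpose]
    congr 1
  rw [h, Matrix.det_mul, h4, Complex.normSq_mul]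
  have : Complex.normSq (star (um e).det) = 1 := by
    rw [← h2]; exact Complex.normSq_conj _
  rw [this, mul_one, Complex.normSq_eq_norm_sq]

lemma hadamard_id (a b c d : ℂ) :
    (Complex.normSq a + Complex.normSq c) * (Complex.normSq b + Complex.normSq d) =
    Complex.normSq (a * d - b * c) + Complex.normSq (star a * b + star c * d) := by
  simp [Complex.normSq_apply]
  ring

lemma sum_dm (φ : Fin 2 × Fin 2 → ℂ) (τ : Fin 2 → Matrix (Fin 2) (Fin 2) ℂ) :
    ∑ p, ∑ q, Complex.normSq (dm φ τ p q) =
    2 * (Complex.normSq (cm φ).det +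
      Complex.normSq (star (φ (0, 0)) * φ (0, 1) + star (φ (1, 0)) * φ (1, 1))) +
    ∑ k, ∑ i, ∑ j, Complex.normSq (φ (i, k) * star (φ (j, k)) - τ k i j) := by
  have := hadamard_id (φ (0, 0)) (φ (0, 1)) (φ (1, 0)) (φ (1, 1))
  rw [Matrix.det_fin_two]
  simp only [cm, Matrix.of_apply]
  rw [← this]
  simp [dm, Fintype.sum_prod_type, Fin.sum_univ_two, Complex.normSq_mul]
  ring

lemma dm_herm (φ : Fin 2 × Fin 2 → ℂ) (τ : Fin 2 → Matrix (Fin 2) (Fin 2) ℂ)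
    (h : ∀ k, (τ k).IsHermitian) : (dm φ τ).IsHermitian := by
  ext ⟨i, k⟩ ⟨j, l⟩
  by_cases hkl : k = l
  · subst hkl
    have := (h k).apply i j
    simp only [dm, Matrix.conjTranspose_apply, Matrix.of_apply, if_true, star_sub, star_mul,
      star_star, this]
  · have : ¬ l = k := fun h => hkl h.symm
    simp only [dm, Matrix.conjTranspose_apply, Matrix.of_apply, if_neg hkl, if_neg this,
      star_mul, star_star, sub_zero]

lemma qc_value (ψ : Fin 2 × Fin 2 → ℂ) (e : Fin 2 → Fin 2 → ℂ)
    (τ : Fin 2 → Matrix (Fin 2) (Fin 2) ℂ)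
    (he : ∀ k l, ∑ i, star (e k i) * e l i = if k = l then (1 : ℂ) else 0)
    (h : ∀ k, (τ k).IsHermitian) :
    (((pureState ψ - ∑ k, τ k ⊗ₖ pureState (e k)) *
      (pureState ψ - ∑ k, τ k ⊗ₖ pureState (e k))).trace).re =
    2 * (‖(cm ψ).det‖ ^ 2 + Complex.normSq (star (vcomp ψ e (0, 0)) * vcomp ψ e (0, 1) +
      star (vcomp ψ e (1, 0)) * vcomp ψ e (1, 1))) +
    ∑ k, ∑ i, ∑ j, Complex.normSq (vcomp ψ e (i, k) * star (vcomp ψ e (j, k)) - τ k i j) := by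
  rw [trace_rot ψ e τ he, trace_sq_herm _ (dm_herm _ _ h), sum_dm, det_comp ψ e he]

lemma exists_basis (ψ : Fin 2 × Fin 2 → ℂ) : ∃ e : Fin 2 → Fin 2 → ℂ,
    (∀ k l, ∑ i, star (e k i) * e l i = if k = l then (1 : ℂ) else 0) ∧
    star (vcomp ψ e (0, 0)) * vcomp ψ e (0, 1) + star (vcomp ψ e (1, 0)) * vcomp ψ e (1, 1) = 0 := by
  have hH := (Matrix.posSemidef_conjTranspose_mul_self (cm ψ)).1
  set U : Matrix (Fin 2) (Fin 2) ℂ := hH.eigenvectorUnitary.1 with hU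
  have hUU : Uᴴ * U = 1 := Matrix.mem_unitaryGroup_iff'.mp hH.eigenvectorUnitary.2
  have hdiag : Uᴴ * ((cm ψ)ᴴ * cm ψ) * U =
      Matrix.diagonal (RCLike.ofReal ∘ hH.eigenvalues) := by
    have := hH.conjStarAlgAut_star_eigenvectorUnitary
    rw [Unitary.conjStarAlgAut_star_apply] at this
    exact this
  refine ⟨fun k j => star (U j k), ?_, ?_⟩
  · intro k l
    have := congrFun (congrFun hUU l) k
    rw [Matrix.one_apply] at this
    simp only [eq_comm (a := k)]
    rw [← this]
    simp [Matrix.mul_apply, mul_comm]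
  · have := congrFun (congrFun hdiag 0) 1
    rw [Matrix.diagonal_apply_ne _ (by decide)] at this
    rw [← this]
    simp [vcomp, Matrix.mul_apply, Fin.sum_univ_two, cm]
    ring

lemma exists_state (v : Fin 2 → ℂ) : ∃ σ : Matrix (Fin 2) (Fin 2) ℂ, IsState σ ∧
    ((∑ i, Complex.normSq (v i) : ℝ) : ℂ) • σ = pureState v := by
  set a := ∑ i, Complex.normSq (v i) with ha
  have ha0 : 0 ≤ a := Finset.sum_nonneg fun i _ => Complex.normSq_nonneg _
  have htr : ∀ w : Fin 2 → ℂ, (pureState w).trace = ((∑ i, Complex.normSq (w i) : ℝ) : ℂ) := by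
    intro w
    simp [pureState, Matrix.trace, Matrix.vecMulVec_apply, Complex.mul_conj]
  by_cases h : a = 0
  · refine ⟨pureState (Pi.single 0 1), ⟨Matrix.posSemidef_vecMulVec_self_star _, ?_⟩, ?_⟩
    · rw [htr]; simp
    · have hv : v = 0 := by
        ext i
        have := (Finset.sum_eq_zero_iff_of_nonneg
          (fun i _ => Complex.normSq_nonneg (v i))).mp h i (Finset.mem_univ i)
        exact Complex.normSq_eq_zero.mp this
      rw [h, hv]
      ext i j
      simp [pureState, Matrix.vecMulVec_apply]
  · have h' : (a : ℂ) ≠ 0 := by exact_mod_cast h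
    refine ⟨(a : ℂ)⁻¹ • pureState v, ⟨?_, ?_⟩, ?_⟩
    · refine Matrix.PosSemidef.smul (Matrix.posSemidef_vecMulVec_self_star _) ?_
      rw [← Complex.ofReal_inv]
      exact_mod_cast inv_nonneg.mpr ha0
    · rw [Matrix.trace_smul, htr, ← ha, smul_eq_mul, inv_mul_cancel₀ h']
    · rw [smul_smul, mul_inv_cancel₀ h', one_smul]

lemma sum_comp (ψ : Fin 2 × Fin 2 → ℂ) (e : Fin 2 → Fin 2 → ℂ)
    (he : ∀ k l, ∑ i, star (e k i) * e l i = if k = l then (1 : ℂ) else 0)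
    (hψ : ∑ i, Complex.normSq (ψ i) = 1) :
    ∑ k, ∑ i, Complex.normSq (vcomp ψ e (i, k)) = 1 := by
  have hu : um e * (um e)ᴴ = 1 := mul_eq_one_comm.mp (um_unit e he)
  have h : ∀ i j, ∑ k, e k i * star (e k j) = if i = j then (1 : ℂ) else 0 := by
    intro i j
    have := congrFun (congrFun hu i) j
    rw [Matrix.one_apply] at this
    rw [← this]
    simp [Matrix.mul_apply, um]
  have h00 := h 0 0
  have h01 := h 0 1
  have h10 := h 1 0
  have h11 := h 1 1
  have hψ' : (∑ i, (Complex.normSq (ψ i) : ℂ)) = 1 := by exact_mod_cast hψ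
  have : (∑ k, ∑ i, (Complex.normSq (vcomp ψ e (i, k)) : ℂ)) = 1 := by
    rw [← hψ']
    simp only [← Complex.mul_conj, vcomp, Fintype.sum_prod_type, Fin.sum_univ_two] at *
    simp at *
    linear_combination (ψ (0,0) * (starRingEnd ℂ) (ψ (0,0)) + ψ (1,0) * (starRingEnd ℂ) (ψ (1,0))) * h00
      + (ψ (0,1) * (starRingEnd ℂ) (ψ (0,1)) + ψ (1,1) * (starRingEnd ℂ) (ψ (1,1))) * h11
      + (ψ (0,1) * (starRingEnd ℂ) (ψ (0,0)) + ψ (1,1) * (starRingEnd ℂ) (ψ (1,0))) * h01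
      + (ψ (0,0) * (starRingEnd ℂ) (ψ (0,1)) + ψ (1,0) * (starRingEnd ℂ) (ψ (1,1))) * h10
  exact_mod_cast this

/-- for any pure two-qubit state `|ψ⟩⟨ψ|` on `ℂ²⊗ℂ²`,
`D_g(|ψ⟩⟨ψ|) = 2 N²`, where `N = (‖ρ^{T₂}‖₁ - 1)/2` is the negativity. -/
theorem stmt5 (ψ : Fin 2 × Fin 2 → ℂ) (hψ : ∑ i, Complex.normSq (ψ i) = 1) :
    Dg (pureState ψ) = 2 * negativity (pureState ψ) ^ 2 := by
  rw [negativity_pure ψ hψ]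
  refine IsLeast.csInf_eq ⟨?_, ?_⟩
  · obtain ⟨e, he, ho⟩ := exists_basis ψ
    choose σ hσ hσ' using fun k => exists_state (fun i => vcomp ψ e (i, k))
    refine ⟨∑ k, pureState (fun i => vcomp ψ e (i, k)) ⊗ₖ pureState (e k),
      ⟨fun k => ∑ i, Complex.normSq (vcomp ψ e (i, k)), σ, e, ?_, sum_comp ψ e he hψ, hσ, he, ?_⟩, ?_⟩
    · exact fun k => Finset.sum_nonneg fun i _ => Complex.normSq_nonneg _
    · refine Finset.sum_congr rfl fun k _ => ?_
      rw [← hσ' k, Matrix.smul_kronecker]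
    · rw [qc_value ψ e (fun k => pureState (fun i => vcomp ψ e (i, k))) he (fun k => (Matrix.posSemidef_vecMulVec_self_star _).1), ho]
      simp [pureState, Matrix.vecMulVec_apply]
  · rintro x ⟨χ, ⟨α, σ, e, hα, -, hσ, he, rfl⟩, rfl⟩
    simp only [← Matrix.smul_kronecker]
    rw [qc_value ψ e (fun k => (α k : ℂ) • σ k) he
      (fun k => ((hσ k).1.smul (by exact_mod_cast hα k)).1)]
    have h1 := Complex.normSq_nonneg (star (vcomp ψ e (0, 0)) * vcomp ψ e (0, 1) +
      star (vcomp ψ e (1, 0)) * vcomp ψ e (1, 1))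
    have h2 : 0 ≤ ∑ k, ∑ i, ∑ j, Complex.normSq
        (vcomp ψ e (i, k) * star (vcomp ψ e (j, k)) - ((α k : ℂ) • σ k) i j) :=
      Finset.sum_nonneg fun k _ => Finset.sum_nonneg fun i _ => Finset.sum_nonneg fun j _ =>
        Complex.normSq_nonneg _
    linarith
end
end

section
/- For any maximally entangled pure two-qudit state ρ_me on ℂ^{d₁}⊗ℂ^{d₂} (d₁,d₂ ≥ 2), the geometric quantum discord equals D_g(ρ_me) = (d−1)/d, where d = min{d₁,d₂}. -/
open Matrix Finset
open scoped Kronecker ComplexOrder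

lemma aux_pure_inner {d₁ d₂ : ℕ} (ψ : Fin d₁ × Fin d₂ → ℂ) (σ : Matrix (Fin d₁) (Fin d₁) ℂ)
    (e : Fin d₂ → ℂ) :
    (pureState ψ * (σ ⊗ₖ pureState e)).trace
      = (pureState (fun i => ∑ j, ψ (i, j) * star (e j)) * σ).trace := by
  simp only [pureState, Matrix.trace, Matrix.diag, Matrix.mul_apply, Matrix.vecMulVec_apply,
    Matrix.kroneckerMap_apply, Fintype.sum_prod_type, Pi.star_apply, star_sum, star_mul, star_star,
    Finset.sum_mul, Finset.mul_sum]
  refine Finset.sum_congr rfl fun i _ => ?_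
  rw [Finset.sum_comm]
  refine Finset.sum_congr rfl fun i' _ => ?_
  rw [Finset.sum_comm]
  refine Finset.sum_congr rfl fun j _ => Finset.sum_congr rfl fun j' _ => ?_
  ring

lemma aux_pure_pure {n : Type*} [Fintype n] (e f : n → ℂ) :
    (pureState e * pureState f).trace
      = (∑ i, star (e i) * f i) * star (∑ i, star (e i) * f i) := by
  simp only [pureState, Matrix.trace, Matrix.diag, Matrix.mul_apply, Matrix.vecMulVec_apply,
    Pi.star_apply, star_sum, star_mul, star_star, Finset.sum_mul, Finset.mul_sum]
  refine Finset.sum_congr rfl fun i _ => Finset.sum_congr rfl fun j _ => ?_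
  ring

lemma aux_herm {n : Type*} (e : n → ℂ) : (pureState e)ᴴ = pureState e := by
  ext i j
  simp [pureState, Matrix.vecMulVec_apply, mul_comm]

lemma aux_normSq {n : Type*} [Fintype n] (e : n → ℂ) :
    (∑ i, star (e i) * e i) = ((∑ i, Complex.normSq (e i) : ℝ) : ℂ) := by
  push_cast
  refine Finset.sum_congr rfl fun i _ => ?_
  rw [Complex.normSq_eq_conj_mul_self]; rfl

/-- The main expansion. -/
lemma aux_expand {d₁ d₂ : ℕ} (ψ : Fin d₁ × Fin d₂ → ℂ) (hψ : ∑ i, Complex.normSq (ψ i) = 1)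
    (α : Fin d₂ → ℝ) (σ : Fin d₂ → Matrix (Fin d₁) (Fin d₁) ℂ) (e : Fin d₂ → Fin d₂ → ℂ)
    (he : ∀ k l, ∑ i, star (e k i) * e l i = if k = l then (1 : ℂ) else 0)
    (φ : Fin d₂ → Fin d₁ → ℂ) (hφ : ∀ k i, φ k i = ∑ j, ψ (i, j) * star (e k j)) :
    ((pureState ψ - ∑ k, (α k : ℂ) • (σ k ⊗ₖ pureState (e k))) *
      (pureState ψ - ∑ k, (α k : ℂ) • (σ k ⊗ₖ pureState (e k)))).trace
    = 1 - ∑ k, (((∑ i, Complex.normSq (φ k i)) ^ 2 : ℝ) : ℂ)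
      + ∑ k, (((α k : ℂ) • σ k - pureState (φ k)) *
        ((α k : ℂ) • σ k - pureState (φ k))).trace := by
  have h1 : (pureState ψ * pureState ψ).trace = 1 := by
    rw [aux_pure_pure, aux_normSq, hψ]; simp
  have h2 : (pureState ψ * ∑ k, (α k : ℂ) • (σ k ⊗ₖ pureState (e k))).trace
      = ∑ k, (α k : ℂ) * (pureState (φ k) * σ k).trace := by
    rw [Matrix.mul_sum, Matrix.trace_sum]
    refine Finset.sum_congr rfl fun k _ => ?_
    rw [Matrix.mul_smul, Matrix.trace_smul, aux_pure_inner, smul_eq_mul, funext (hφ k)]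
  have h3 : ((∑ k, (α k : ℂ) • (σ k ⊗ₖ pureState (e k))) *
      ∑ k, (α k : ℂ) • (σ k ⊗ₖ pureState (e k))).trace
      = ∑ k, (α k : ℂ) * ((α k : ℂ) * (σ k * σ k).trace) := by
    rw [Matrix.sum_mul, Matrix.trace_sum]
    refine Finset.sum_congr rfl fun k _ => ?_
    rw [Matrix.mul_sum, Matrix.trace_sum, Finset.sum_eq_single k]
    · rw [Matrix.smul_mul, Matrix.mul_smul, ← Matrix.mul_kronecker_mul, Matrix.trace_smul,
        Matrix.trace_smul, Matrix.trace_kronecker, aux_pure_pure, he]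
      simp
    · intro l _ hl
      rw [Matrix.smul_mul, Matrix.mul_smul, ← Matrix.mul_kronecker_mul, Matrix.trace_smul,
        Matrix.trace_smul, Matrix.trace_kronecker, aux_pure_pure, he]
      simp [hl.symm]
    · simp
  have h4 : ∀ k, (((α k : ℂ) • σ k - pureState (φ k)) *
        ((α k : ℂ) • σ k - pureState (φ k))).trace
      = (α k : ℂ) * ((α k : ℂ) * (σ k * σ k).trace)
        - 2 * ((α k : ℂ) * (pureState (φ k) * σ k).trace)
        + (((∑ i, Complex.normSq (φ k i)) ^ 2 : ℝ) : ℂ) := by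
    intro k
    rw [sub_mul, mul_sub, mul_sub]
    simp only [Matrix.trace_sub, Matrix.smul_mul, Matrix.mul_smul, Matrix.trace_smul, smul_eq_mul]
    rw [Matrix.trace_mul_comm (σ k) (pureState (φ k)), aux_pure_pure, aux_normSq]
    rw [Complex.star_def, Complex.conj_ofReal]
    push_cast
    ring
  rw [sub_mul, mul_sub, mul_sub]
  simp only [Matrix.trace_sub]
  rw [Matrix.trace_mul_comm (∑ k, (α k : ℂ) • (σ k ⊗ₖ pureState (e k))) (pureState ψ), h1, h2, h3]
  simp only [h4, Finset.sum_add_distrib, Finset.sum_sub_distrib, ← Finset.mul_sum]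
  ring

lemma aux_tr_nonneg {n : Type*} [Fintype n] (A : Matrix n n ℂ) (hA : Aᴴ = A) :
    0 ≤ ((A * A).trace).re := by
  have h := (Matrix.posSemidef_conjTranspose_mul_self A).trace_nonneg
  rw [hA] at h
  exact (Complex.le_def.1 h).1

/-- The matrix of coefficients. -/
lemma aux_R {d₁ d₂ : ℕ} (ψ : Fin d₁ × Fin d₂ → ℂ)
    (hme₁ : min d₁ d₂ = d₁ →
      ptrace2 (pureState ψ) = ((d₁ : ℂ))⁻¹ • (1 : Matrix (Fin d₁) (Fin d₁) ℂ))
    (hme₂ : min d₁ d₂ = d₂ →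
      ptrace1 (pureState ψ) = ((d₂ : ℂ))⁻¹ • (1 : Matrix (Fin d₂) (Fin d₂) ℂ))
    (M : Matrix (Fin d₁) (Fin d₂) ℂ) (hM : ∀ i j, M i j = ψ (i, j)) :
    (Mᴴ * M) * (Mᴴ * M) = ((min d₁ d₂ : ℕ) : ℂ)⁻¹ • (Mᴴ * M) := by
  rcases le_total d₁ d₂ with h | h
  · have h1 := hme₁ (min_eq_left h)
    have h2 : M * Mᴴ = ((d₁ : ℂ))⁻¹ • (1 : Matrix (Fin d₁) (Fin d₁) ℂ) := by
      rw [← h1]; ext i j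
      simp [ptrace2, pureState, Matrix.mul_apply, Matrix.vecMulVec_apply, hM]
    rw [min_eq_left h, Matrix.mul_assoc, ← Matrix.mul_assoc M, h2]
    simp
  · have h1 := hme₂ (min_eq_right h)
    have h2 : Mᴴ * M = ((d₂ : ℂ))⁻¹ • (1 : Matrix (Fin d₂) (Fin d₂) ℂ) := by
      rw [← Matrix.transpose_inj, Matrix.transpose_smul, Matrix.transpose_one, ← h1]; ext i j
      simp [ptrace1, pureState, Matrix.mul_apply, Matrix.vecMulVec_apply, hM, mul_comm]
    rw [min_eq_right h, h2]
    simp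

/-- Rotated coefficient matrix facts. -/
lemma aux_S {d₁ d₂ : ℕ} (ψ : Fin d₁ × Fin d₂ → ℂ) (hψ : ∑ i, Complex.normSq (ψ i) = 1)
    (M : Matrix (Fin d₁) (Fin d₂) ℂ) (hM : ∀ i j, M i j = ψ (i, j)) (c : ℂ)
    (hR : (Mᴴ * M) * (Mᴴ * M) = c • (Mᴴ * M))
    (V : Matrix (Fin d₂) (Fin d₂) ℂ) (hV : Vᴴ * V = 1) :
    ((M * V)ᴴ * (M * V)).trace = 1 ∧
    ((M * V)ᴴ * (M * V)) * ((M * V)ᴴ * (M * V)) = c • ((M * V)ᴴ * (M * V)) := by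
  have hV' : V * Vᴴ = 1 := mul_eq_one_comm.1 hV
  have e : (M * V)ᴴ * (M * V) = Vᴴ * (Mᴴ * M) * V := by
    rw [Matrix.conjTranspose_mul]; simp only [Matrix.mul_assoc]
  rw [e]
  constructor
  · rw [Matrix.trace_mul_comm, ← Matrix.mul_assoc, hV', Matrix.one_mul]
    have : (Mᴴ * M).trace = ((∑ i, Complex.normSq (ψ i) : ℝ) : ℂ) := by
      rw [← aux_normSq, Fintype.sum_prod_type, Finset.sum_comm]
      simp [Matrix.trace, Matrix.mul_apply, hM]
    rw [this, hψ]; simp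
  · calc Vᴴ * (Mᴴ * M) * V * (Vᴴ * (Mᴴ * M) * V)
        = Vᴴ * (Mᴴ * M) * (V * Vᴴ) * (Mᴴ * M) * V := by simp only [Matrix.mul_assoc]
      _ = Vᴴ * ((Mᴴ * M) * (Mᴴ * M)) * V := by rw [hV']; simp only [Matrix.mul_assoc, Matrix.one_mul]
      _ = _ := by rw [hR]; simp

lemma aux_diag {d₁ d₂ : ℕ} (N : Matrix (Fin d₁) (Fin d₂) ℂ) (k : Fin d₂) :
    (Nᴴ * N) k k = ((∑ i, Complex.normSq (N i k) : ℝ) : ℂ) := by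
  rw [← aux_normSq]; simp [Matrix.mul_apply]

/-- For a Hermitian matrix the square's diagonal. -/
lemma aux_sq_diag {n : Type*} [Fintype n] (S : Matrix n n ℂ) (hS : Sᴴ = S) (k : n) :
    (S * S) k k = ((∑ l, Complex.normSq (S l k) : ℝ) : ℂ) := by
  rw [← aux_normSq, Matrix.mul_apply]
  refine Finset.sum_congr rfl fun l _ => ?_
  conv_lhs => rw [← hS]
  simp [Matrix.conjTranspose_apply]
  left
  conv_lhs => rw [← hS]
  simp [Matrix.conjTranspose_apply]

/-- for any maximally entangled pure two-qudit state on `ℂ^{d₁}⊗ℂ^{d₂}`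
(the reduced state on the lower-dimensional factor is maximally mixed),
`D_g(ρ_me) = (d-1)/d` with `d = min{d₁, d₂}`. -/
theorem stmt7 {d₁ d₂ : ℕ} (hd₁ : 2 ≤ d₁) (hd₂ : 2 ≤ d₂)
    (ψ : Fin d₁ × Fin d₂ → ℂ) (hψ : ∑ i, Complex.normSq (ψ i) = 1)
    (hme₁ : min d₁ d₂ = d₁ →
      ptrace2 (pureState ψ) = ((d₁ : ℂ))⁻¹ • (1 : Matrix (Fin d₁) (Fin d₁) ℂ))
    (hme₂ : min d₁ d₂ = d₂ →
      ptrace1 (pureState ψ) = ((d₂ : ℂ))⁻¹ • (1 : Matrix (Fin d₂) (Fin d₂) ℂ)) :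
    Dg (pureState ψ) = ((min d₁ d₂ : ℝ) - 1) / (min d₁ d₂ : ℝ) := by
  obtain ⟨M, hM⟩ : ∃ M : Matrix (Fin d₁) (Fin d₂) ℂ, ∀ i j, M i j = ψ (i, j) :=
    ⟨Matrix.of fun i j => ψ (i, j), fun _ _ => rfl⟩
  have hR := aux_R ψ hme₁ hme₂ M hM
  have hdpos : 0 < min d₁ d₂ := by omega
  have hmin : (min (d₁ : ℝ) (d₂ : ℝ)) = ((min d₁ d₂ : ℕ) : ℝ) := by push_cast; rfl
  rw [hmin]
  generalize min d₁ d₂ = d at hR hdpos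
  have hd0 : (0 : ℝ) < d := by exact_mod_cast hdpos
  have hcd : ((d : ℂ))⁻¹ = (((d : ℝ)⁻¹ : ℝ) : ℂ) := by push_cast; rfl
  rw [hcd] at hR
  have htarget : ((d : ℝ) - 1) / d = 1 - (d : ℝ)⁻¹ := by field_simp
  rw [htarget]
  have key : IsLeast {x : ℝ | ∃ χ, IsQCState χ ∧
      x = (((pureState ψ - χ) * (pureState ψ - χ)).trace).re} (1 - (d : ℝ)⁻¹) := by
    constructor
    · -- attained at the eigenbasis
      have hH : (Mᴴ * M).IsHermitian := Matrix.isHermitian_conjTranspose_mul_self M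
      obtain ⟨V, D, hV, hD⟩ : ∃ (V : Matrix (Fin d₂) (Fin d₂) ℂ) (D : Fin d₂ → ℂ), Vᴴ * V = 1 ∧
          Vᴴ * (Mᴴ * M) * V = Matrix.diagonal D := by
        refine ⟨hH.eigenvectorUnitary, RCLike.ofReal ∘ hH.eigenvalues, ?_, ?_⟩
        rotate_left
        · have := hH.conjStarAlgAut_star_eigenvectorUnitary
          rw [Unitary.conjStarAlgAut_star_apply] at this
          exact this
        · exact Unitary.coe_star_mul_self hH.eigenvectorUnitary
      obtain ⟨htr, hsq⟩ := aux_S ψ hψ M hM _ hR V hV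
      set x : Fin d₂ → ℝ := fun k => ∑ i, Complex.normSq ((M * V) i k) with hx
      have hx0 : ∀ k, 0 ≤ x k := fun k => Finset.sum_nonneg fun i _ => Complex.normSq_nonneg _
      have hS : (M * V)ᴴ * (M * V) = Matrix.diagonal (fun k => (x k : ℂ)) := by
        have e : (M * V)ᴴ * (M * V) = Matrix.diagonal D := by
          rw [← hD, Matrix.conjTranspose_mul]; simp only [Matrix.mul_assoc]
        rw [e]
        congr 1
        funext k
        have := aux_diag (M * V) k
        rw [e, Matrix.diagonal_apply_eq] at this
        exact this
      have hxsum : ∑ k, x k = 1 := by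
        rw [hS, Matrix.trace_diagonal] at htr
        exact_mod_cast htr
      have hxsq : ∀ k, x k ^ 2 = (d : ℝ)⁻¹ * x k := by
        intro k
        have := congrFun (congrFun hsq k) k
        rw [hS, Matrix.diagonal_mul_diagonal, Matrix.smul_apply, Matrix.diagonal_apply_eq,
          Matrix.diagonal_apply_eq, smul_eq_mul] at this
        rw [sq]
        exact_mod_cast this
      set φ : Fin d₂ → Fin d₁ → ℂ := fun k i => (M * V) i k with hφdef
      have hφx : ∀ k, ∑ i, Complex.normSq (φ k i) = x k := fun k => rfl
      have htrφ : ∀ k, (pureState (φ k)).trace = (x k : ℂ) := by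
        intro k
        rw [← hφx, ← aux_normSq]
        simp [pureState, Matrix.trace, Matrix.vecMulVec_apply, mul_comm]
      have i₀ : Fin d₁ := ⟨0, by omega⟩
      have hstate : ∀ k, ∃ σ : Matrix (Fin d₁) (Fin d₁) ℂ, IsState σ ∧
          (x k : ℂ) • σ = pureState (φ k) := by
        intro k
        by_cases h0 : x k = 0
        · refine ⟨pureState (Pi.single i₀ 1), ⟨Matrix.posSemidef_vecMulVec_self_star _, ?_⟩, ?_⟩
          · rw [pureState, Matrix.trace_vecMulVec]
            simp [dotProduct, Pi.single_apply]
          · have hz : φ k = 0 := by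
              funext i
              have h1 := hφx k
              rw [h0, Finset.sum_eq_zero_iff_of_nonneg
                (fun i _ => Complex.normSq_nonneg _)] at h1
              exact Complex.normSq_eq_zero.1 (h1 i (Finset.mem_univ i))
            rw [h0, hz]
            simp [pureState]
        · have h0' : (x k : ℂ) ≠ 0 := by exact_mod_cast h0
          refine ⟨(x k : ℂ)⁻¹ • pureState (φ k), ⟨?_, ?_⟩, ?_⟩
          · refine (Matrix.posSemidef_vecMulVec_self_star (φ k)).smul ?_
            rw [← Complex.ofReal_inv]
            exact_mod_cast inv_nonneg.2 (hx0 k)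
          · rw [Matrix.trace_smul, htrφ, smul_eq_mul, inv_mul_cancel₀ h0']
          · rw [smul_smul, mul_inv_cancel₀ h0', one_smul]
      choose σ hσ hσφ using hstate
      have he : ∀ k l, ∑ i, star ((fun k j => star (V j k)) k i) * (fun k j => star (V j k)) l i
          = if k = l then (1 : ℂ) else 0 := by
        intro k l
        have := congrFun (congrFun hV l) k
        rw [Matrix.mul_apply, Matrix.one_apply] at this
        simp only [star_star]
        simp only [Matrix.conjTranspose_apply] at this
        rw [if_congr (eq_comm) rfl rfl, ← this]
        exact Finset.sum_congr rfl fun i _ => mul_comm _ _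
      refine ⟨_, ⟨x, σ, fun k j => star (V j k), hx0, hxsum, hσ, he, rfl⟩, ?_⟩
      rw [aux_expand ψ hψ x σ _ he φ (fun k i => by simp [hφdef, Matrix.mul_apply, hM])]
      simp only [hσφ, sub_self, Matrix.zero_mul, Matrix.trace_zero, Finset.sum_const_zero, add_zero,
        hφx, hxsq]
      rw [← Complex.ofReal_sum, ← Finset.mul_sum, hxsum, ← Complex.ofReal_one,
        ← Complex.ofReal_sub, Complex.ofReal_re]
      ring
    · rintro y ⟨χ, ⟨α, σ, e, hα, hα1, hσ, he, rfl⟩, rfl⟩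
      set V : Matrix (Fin d₂) (Fin d₂) ℂ := Matrix.of fun j k => star (e k j) with hVdef
      have hV : Vᴴ * V = 1 := by
        ext k l
        rw [Matrix.mul_apply, Matrix.one_apply, if_congr (eq_comm) rfl rfl, ← he l k]
        refine Finset.sum_congr rfl fun i _ => ?_
        simp [hVdef, mul_comm]
      obtain ⟨htr, hsq⟩ := aux_S ψ hψ M hM _ hR V hV
      set φ : Fin d₂ → Fin d₁ → ℂ := fun k i => (M * V) i k with hφdef
      rw [aux_expand ψ hψ α σ e he φ
        (fun k i => by simp [hφdef, hVdef, Matrix.mul_apply, hM])]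
      have hpos : ∀ k, 0 ≤ ((((α k : ℂ) • σ k - pureState (φ k)) *
          ((α k : ℂ) • σ k - pureState (φ k))).trace).re := by
        intro k
        apply aux_tr_nonneg
        rw [Matrix.conjTranspose_sub, aux_herm, Matrix.conjTranspose_smul, (hσ k).1.1.eq]
        simp
      have hsum1 : ∑ k, (∑ i, Complex.normSq (φ k i)) = 1 := by
        have : (((∑ k, (∑ i, Complex.normSq (φ k i)) : ℝ)) : ℂ) = 1 := by
          rw [← htr, Complex.ofReal_sum]
          exact Finset.sum_congr rfl fun k _ => (aux_diag (M * V) k).symm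
        exact_mod_cast this
      have hle : ∀ k, (∑ i, Complex.normSq (φ k i)) ^ 2
          ≤ (d : ℝ)⁻¹ * ∑ i, Complex.normSq (φ k i) := by
        intro k
        have h1 := congrFun (congrFun hsq k) k
        rw [aux_sq_diag _ (Matrix.isHermitian_conjTranspose_mul_self _).eq, Matrix.smul_apply,
          aux_diag, smul_eq_mul] at h1
        have h2 : ∑ l, Complex.normSq (((M * V)ᴴ * (M * V)) l k)
            = (d : ℝ)⁻¹ * ∑ i, Complex.normSq (φ k i) := by exact_mod_cast h1
        rw [← h2]
        refine le_trans (le_of_eq ?_) (Finset.single_le_sum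
          (f := fun l => Complex.normSq (((M * V)ᴴ * (M * V)) l k))
          (fun l _ => Complex.normSq_nonneg _) (Finset.mem_univ k))
        rw [aux_diag, Complex.normSq_ofReal, sq]
      have hS := Finset.sum_le_sum fun k (_ : k ∈ Finset.univ) => hle k
      rw [← Finset.mul_sum, hsum1, mul_one] at hS
      have hP := Finset.sum_nonneg fun k (_ : k ∈ Finset.univ) => hpos k
      rw [← Complex.ofReal_sum, Complex.add_re, Complex.sub_re, Complex.one_re, Complex.ofReal_re,
        Complex.re_sum]
      linarith
  exact key.csInf_eq
end

section
/- For an arbitrary two-qudit state ρ on ℂ^{d₁}⊗ℂ^{d₂} (d₁,d₂ ≥ 2), pure or mixed, the geometric quantum discord satisfies D_g(ρ) ≤ ((d₂−1)/d₂)·[1 − ‖r₂‖²/(d₂+1)] ≤ (d₂−1)/d₂, where r₂ ∈ ℝ^{d₂²−1} is the Bloch vector of the reduced state ρ₂ = tr₁ρ relative to any Bloch basis Υ₂. -/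
open Matrix Finset
open scoped Kronecker ComplexOrder

open Complex in
/-- A Hermitian matrix has nonnegative trace of its square. -/
lemma herm_sq_trace_nonneg {n : Type*} [Fintype n] {X : Matrix n n ℂ} (hX : X.IsHermitian) :
    0 ≤ ((X * X).trace).re := by
  have h := (Matrix.posSemidef_conjTranspose_mul_self X).trace_nonneg
  rw [hX.eq] at h
  exact (Complex.le_def.1 h).1

lemma trace_mul_proj_nonneg {n : Type*} [Fintype n] {M T : Matrix n n ℂ} (hM : M.PosSemidef)
    (hT : T.IsHermitian) {c : ℝ} (hc : 0 < c) (hTT : T * T = (c : ℂ) • T) :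
    0 ≤ ((M * T).trace).re := by
  have h := (hM.conjTranspose_mul_mul_same T).trace_nonneg
  rw [hT.eq, Matrix.mul_assoc, Matrix.trace_mul_comm, Matrix.mul_assoc, hTT, Matrix.mul_smul,
    Matrix.trace_smul] at h
  have h2 := (Complex.le_def.1 h).1
  simp at h2
  exact nonneg_of_mul_nonneg_right h2 hc

/-- The matrix of an involution. -/
def invMat {n : Type*} [DecidableEq n] (f : n → n) : Matrix n n ℂ :=
  Matrix.of fun p q => if q = f p then 1 else 0

lemma invMat_mul {n : Type*} [Fintype n] [DecidableEq n] (f g : n → n) :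
    invMat f * invMat g = invMat (fun x => g (f x)) := by
  ext p q
  simp only [invMat, Matrix.mul_apply, Matrix.of_apply, ite_mul, one_mul, zero_mul,
    Finset.sum_ite_eq', Finset.sum_ite_eq, Finset.mem_univ, if_true]

lemma invMat_id {n : Type*} [Fintype n] [DecidableEq n] :
    invMat (fun x : n => x) = 1 := by
  ext p q
  simp [invMat, Matrix.one_apply, eq_comm]

lemma invMat_herm {n : Type*} [DecidableEq n] (f : n → n) (hf : ∀ x, f (f x) = x) :
    (invMat f).IsHermitian := by
  ext p q
  have : p = f q ↔ q = f p := ⟨fun h => by rw [h, hf], fun h => by rw [h, hf]⟩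
  simp only [invMat, Matrix.conjTranspose_apply, Matrix.of_apply, this]
  split_ifs <;> simp

lemma trace_mul_invMat {n : Type*} [Fintype n] [DecidableEq n] (M : Matrix n n ℂ) (f : n → n)
    (hf : ∀ x, f (f x) = x) :
    (M * invMat f).trace = ∑ p, M p (f p) := by
  have : ∀ p q, p = f q ↔ q = f p := fun p q =>
    ⟨fun h => by rw [h, hf], fun h => by rw [h, hf]⟩
  simp only [Matrix.trace, Matrix.mul_apply, invMat, Matrix.diag_apply, Matrix.of_apply,
    mul_ite, mul_one, mul_zero]
  refine Finset.sum_congr rfl fun p _ => ?_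
  rw [Finset.sum_congr rfl fun q _ => if_congr (this p q) rfl rfl]
  simp

lemma purity_le_one {n : Type*} [Fintype n] [DecidableEq n] {ρ : Matrix n n ℂ} (hρ : IsState ρ) :
    ((ρ * ρ).trace).re ≤ 1 := by
  have hM := hρ.1.kronecker hρ.1
  let f : n × n → n × n := fun p => (p.2, p.1)
  have hf : ∀ x, f (f x) = x := fun x => rfl
  have hff : invMat f * invMat f = 1 := by rw [invMat_mul]; simp only [hf]; exact invMat_id
  have h := trace_mul_proj_nonneg hM (T := 1 - invMat f)
    (Matrix.isHermitian_one.sub (invMat_herm f hf)) (c := 2) (by norm_num) (by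
      rw [mul_sub, sub_mul, sub_mul, hff]
      simp only [one_mul, mul_one]
      push_cast
      rw [two_smul]; abel)
  rw [mul_sub, mul_one, Matrix.trace_sub, trace_mul_invMat _ f hf, Matrix.trace_kronecker, hρ.2] at h
  have e : ∑ p, (ρ ⊗ₖ ρ) p (f p) = (ρ * ρ).trace := by
    simp [f, Fintype.sum_prod_type, Matrix.trace, Matrix.mul_apply]
  rw [e] at h
  simp at h
  linarith

lemma purity_ineq {d₁ d₂ : ℕ} {ρ : Matrix (Fin d₁ × Fin d₂) (Fin d₁ × Fin d₂) ℂ}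
    (hρ : IsState ρ) :
    ((ptrace1 ρ * ptrace1 ρ).trace).re + ((ρ * ρ).trace).re
      ≤ 1 + ((ptrace2 ρ * ptrace2 ρ).trace).re := by
  have hM := hρ.1.kronecker hρ.1
  let I := (Fin d₁ × Fin d₂) × (Fin d₁ × Fin d₂)
  let f : I → I := fun p => ((p.2.1, p.1.2), (p.1.1, p.2.2))
  let g : I → I := fun p => ((p.1.1, p.2.2), (p.2.1, p.1.2))
  let s : I → I := fun p => (p.2, p.1)
  have hf : ∀ x, f (f x) = x := fun x => rfl
  have hg : ∀ x, g (g x) = x := fun x => rfl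
  have hs : ∀ x, s (s x) = x := fun x => rfl
  have e1 : invMat f * invMat f = 1 := by rw [invMat_mul]; exact invMat_id
  have e2 : invMat g * invMat g = 1 := by rw [invMat_mul]; exact invMat_id
  have e3 : invMat s * invMat s = 1 := by rw [invMat_mul]; exact invMat_id
  have e4 : invMat f * invMat g = invMat s := by rw [invMat_mul]
  have e5 : invMat g * invMat f = invMat s := by rw [invMat_mul]
  have e6 : invMat f * invMat s = invMat g := by rw [invMat_mul]
  have e7 : invMat s * invMat f = invMat g := by rw [invMat_mul]
  have e8 : invMat g * invMat s = invMat f := by rw [invMat_mul]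
  have e9 : invMat s * invMat g = invMat f := by rw [invMat_mul]
  have h := trace_mul_proj_nonneg hM (T := 1 + invMat f - invMat g - invMat s)
    (((Matrix.isHermitian_one.add (invMat_herm f hf)).sub (invMat_herm g hg)).sub
      (invMat_herm s hs)) (c := 4) (by norm_num) (by
      simp only [mul_sub, sub_mul, mul_add, add_mul, e1, e2, e3, e4, e5, e6, e7, e8, e9,
        one_mul, mul_one]
      push_cast
      module)
  rw [mul_sub, mul_sub, mul_add, mul_one, Matrix.trace_sub, Matrix.trace_sub, Matrix.trace_add,
    trace_mul_invMat _ f hf, trace_mul_invMat _ g hg, trace_mul_invMat _ s hs,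
    Matrix.trace_kronecker, hρ.2] at h
  have t1 : ∑ p, (ρ ⊗ₖ ρ) p (s p) = (ρ * ρ).trace := by
    simp only [s, I, Fintype.sum_prod_type (α₁ := Fin d₁ × Fin d₂), Matrix.trace, Matrix.mul_apply,
      Matrix.kroneckerMap_apply, Matrix.diag_apply]
  have t2 : ∑ p, (ρ ⊗ₖ ρ) p (f p) = (ptrace2 ρ * ptrace2 ρ).trace := by
    simp only [f, I, Fintype.sum_prod_type, Matrix.trace, Matrix.mul_apply,
      Matrix.kroneckerMap_apply, Matrix.diag_apply, ptrace2, Matrix.of_apply, Finset.sum_mul_sum]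
    refine Finset.sum_congr rfl fun i _ => ?_
    rw [Finset.sum_comm]
  have t3 : ∑ p, (ρ ⊗ₖ ρ) p (g p) = (ptrace1 ρ * ptrace1 ρ).trace := by
    simp only [g, I, Fintype.sum_prod_type, Matrix.trace, Matrix.mul_apply,
      Matrix.kroneckerMap_apply, Matrix.diag_apply, ptrace1, Matrix.of_apply, Finset.sum_mul_sum]
    rw [Finset.sum_comm]
    refine Finset.sum_congr rfl fun i _ => ?_
    conv_rhs => rw [Finset.sum_comm]
    refine Finset.sum_congr rfl fun j _ => ?_
    rw [Finset.sum_comm]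
  rw [t1, t2, t3] at h
  simp at h
  linarith

lemma bessel {d : ℕ} (hd : 2 ≤ d) {τ : Matrix (Fin d) (Fin d) ℂ} (hτ : τ.IsHermitian)
    (ht : τ.trace = 1) {Υ : Fin (d ^ 2 - 1) → Matrix (Fin d) (Fin d) ℂ} (hΥ : IsBlochBasis d Υ) :
    ∑ k, (((τ * Υ k).trace).re) ^ 2 ≤ 2 * (((τ * τ).trace).re - 1 / d) := by
  obtain ⟨-, hH, h0, h2⟩ := hΥ
  have hd0 : (d : ℂ) ≠ 0 := by exact_mod_cast (by omega : d ≠ 0)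
  set c : Fin (d ^ 2 - 1) → ℝ := fun k => ((τ * Υ k).trace).re with hc
  have hreal : ∀ k, (τ * Υ k).trace = (c k : ℂ) := by
    intro k
    have : star ((τ * Υ k).trace) = (τ * Υ k).trace := by
      rw [← Matrix.trace_conjTranspose, Matrix.conjTranspose_mul, hτ.eq, (hH k).eq,
        Matrix.trace_mul_comm]
    exact (Complex.conj_eq_iff_re.1 this).symm
  set Z : Matrix (Fin d) (Fin d) ℂ := ∑ k, ((c k / 2 : ℝ) : ℂ) • Υ k with hZ
  have hZH : Z.IsHermitian := by
    unfold Matrix.IsHermitian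
    rw [hZ, Matrix.conjTranspose_sum]
    refine Finset.sum_congr rfl fun k _ => ?_
    rw [Matrix.conjTranspose_smul, (hH k).eq]
    simp
  have hZ0 : Z.trace = 0 := by
    rw [hZ, Matrix.trace_sum]
    simp [h0]
  have hτZ : (τ * Z).trace = ((∑ k, c k ^ 2 / 2 : ℝ) : ℂ) := by
    rw [hZ, Matrix.mul_sum, Matrix.trace_sum]
    simp only [Matrix.mul_smul, Matrix.trace_smul, hreal]
    push_cast
    refine Finset.sum_congr rfl fun k _ => ?_
    simp; ring
  have hZZ : (Z * Z).trace = ((∑ k, c k ^ 2 / 2 : ℝ) : ℂ) := by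
    conv_lhs => rw [hZ]
    rw [Matrix.sum_mul, Matrix.trace_sum]
    simp only [Matrix.mul_sum, Matrix.trace_sum, Matrix.mul_smul, Matrix.smul_mul,
      Matrix.trace_smul, h2]
    push_cast
    refine Finset.sum_congr rfl fun k _ => ?_
    simp; ring
  have hDH : ((1 / (d : ℂ)) • (1 : Matrix (Fin d) (Fin d) ℂ)).IsHermitian := by
    unfold Matrix.IsHermitian
    rw [Matrix.conjTranspose_smul]
    simp
  have h := herm_sq_trace_nonneg ((hτ.sub hDH).sub hZH)
  have e : ((τ - (1 / (d : ℂ)) • (1 : Matrix (Fin d) (Fin d) ℂ) - Z) *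
      (τ - (1 / (d : ℂ)) • (1 : Matrix (Fin d) (Fin d) ℂ) - Z)).trace
      = (τ * τ).trace - ((1 / d : ℝ) : ℂ) - ((∑ k, c k ^ 2 / 2 : ℝ) : ℂ) := by
    simp only [mul_sub, sub_mul, Matrix.trace_sub, Matrix.mul_smul, Matrix.smul_mul, mul_one,
      one_mul, Matrix.trace_smul, hZZ, hτZ, Matrix.trace_mul_comm Z τ, hZ0, ht, Matrix.trace_one]
    simp
    field_simp
    ring
  rw [e] at h
  simp only [Complex.sub_re, Complex.ofReal_re, ← Finset.sum_div] at h
  linarith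

/-- The (unnormalised) conditional operator `⟨ψ|ρ|ψ⟩` on the first factor. -/
def condOp {d₁ d₂ : ℕ} (ρ : Matrix (Fin d₁ × Fin d₂) (Fin d₁ × Fin d₂) ℂ) (ψ : Fin d₂ → ℂ) :
    Matrix (Fin d₁) (Fin d₁) ℂ :=
  Matrix.of fun i i' => ∑ a, ∑ b, star (ψ a) * ψ b * ρ (i, a) (i', b)

lemma condOp_posSemidef {d₁ d₂ : ℕ} {ρ : Matrix (Fin d₁ × Fin d₂) (Fin d₁ × Fin d₂) ℂ}
    (hρ : ρ.PosSemidef) (ψ : Fin d₂ → ℂ) : (condOp ρ ψ).PosSemidef := by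
  let B : Matrix (Fin d₁ × Fin d₂) (Fin d₁) ℂ := Matrix.of fun p i => if p.1 = i then ψ p.2 else 0
  have h := hρ.conjTranspose_mul_mul_same B
  have e : Bᴴ * ρ * B = condOp ρ ψ := by
    ext i i'
    simp only [B, condOp, Matrix.mul_apply, Matrix.conjTranspose_apply, Matrix.of_apply,
      Fintype.sum_prod_type, apply_ite star, star_zero, ite_mul, zero_mul, mul_ite, mul_zero]
    simp only [Finset.sum_mul]
    rw [Finset.sum_comm]
    simp only [Finset.sum_comm (s := (Finset.univ : Finset (Fin d₂))) (t := (Finset.univ : Finset (Fin d₁)))]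
    simp
    rw [Finset.sum_comm]
    refine Finset.sum_congr rfl fun a _ => Finset.sum_congr rfl fun b _ => ?_
    ring
  rwa [e] at h

lemma trace_mul_kron_pure {d₁ d₂ : ℕ} (ρ : Matrix (Fin d₁ × Fin d₂) (Fin d₁ × Fin d₂) ℂ)
    (R : Matrix (Fin d₁) (Fin d₁) ℂ) (ψ : Fin d₂ → ℂ) :
    (ρ * (R ⊗ₖ pureState ψ)).trace = (condOp ρ ψ * R).trace := by
  simp only [Matrix.trace, Matrix.diag_apply, Matrix.mul_apply, Fintype.sum_prod_type,
    Matrix.kroneckerMap_apply, pureState, Matrix.vecMulVec_apply, condOp, Matrix.of_apply,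
    Pi.star_apply, Finset.sum_mul]
  refine Finset.sum_congr rfl fun i _ => ?_
  rw [Finset.sum_comm]
  refine Finset.sum_congr rfl fun i' _ => Finset.sum_congr rfl fun a _ =>
    Finset.sum_congr rfl fun b _ => ?_
  ring

lemma exists_state_s8 {d : ℕ} (hd : 2 ≤ d) : ∃ σ : Matrix (Fin d) (Fin d) ℂ, IsState σ := by
  refine ⟨(1 / (d : ℂ)) • 1, Matrix.PosSemidef.one.smul ?_, ?_⟩
  · have : (0 : ℂ) ≤ ((1 / d : ℝ) : ℂ) := by
      rw [Complex.zero_le_real]; positivity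
    simpa using this
  · have hd0 : (d : ℂ) ≠ 0 := by exact_mod_cast (by omega : d ≠ 0)
    simp [Matrix.trace_smul, hd0]

lemma posSemidef_trace_real {n : Type*} [Fintype n] {R : Matrix n n ℂ} (hR : R.PosSemidef) :
    0 ≤ R.trace.re ∧ R.trace = (R.trace.re : ℂ) := by
  have := Complex.le_def.1 hR.trace_nonneg
  refine ⟨this.1, ?_⟩
  apply Complex.ext
  · simp
  · simpa using this.2.symm

lemma posSemidef_normalize {d : ℕ} (hd : 2 ≤ d) {R : Matrix (Fin d) (Fin d) ℂ}
    (hR : R.PosSemidef) : ∃ σ, IsState σ ∧ (R.trace.re : ℂ) • σ = R := by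
  obtain ⟨h0, h1⟩ := posSemidef_trace_real hR
  by_cases h : R.trace = 0
  · obtain ⟨σ, hσ⟩ := exists_state_s8 hd
    refine ⟨σ, hσ, ?_⟩
    rw [← h1, h, zero_smul]
    exact (hR.trace_eq_zero_iff.1 h).symm
  · refine ⟨(R.trace)⁻¹ • R, ⟨hR.smul ?_, ?_⟩, ?_⟩
    · rw [h1, ← Complex.ofReal_inv, Complex.zero_le_real]; positivity
    · simp [Matrix.trace_smul, h]
    · rw [← h1, smul_smul, mul_inv_cancel₀ h, one_smul]

lemma qc_herm {d₁ d₂ : ℕ} {χ : Matrix (Fin d₁ × Fin d₂) (Fin d₁ × Fin d₂) ℂ}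
    (h : IsQCState χ) : χ.IsHermitian := by
  obtain ⟨α, σ, e, -, -, hσ, -, rfl⟩ := h
  unfold Matrix.IsHermitian
  rw [Matrix.conjTranspose_sum]
  refine Finset.sum_congr rfl fun k _ => ?_
  rw [Matrix.conjTranspose_smul, Matrix.conjTranspose_kronecker, (hσ k).1.1.eq]
  simp [pureState, Matrix.conjTranspose_vecMulVec]

/-- Orthonormality of a family. -/
def IsON {d : ℕ} (e : Fin d → Fin d → ℂ) : Prop :=
  ∀ k l, ∑ i, star (e k i) * e l i = if k = l then (1 : ℂ) else 0

lemma IsON.complete {d : ℕ} {e : Fin d → Fin d → ℂ} (he : IsON e) (a b : Fin d) :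
    ∑ k, star (e k a) * e k b = if a = b then (1 : ℂ) else 0 := by
  let U : Matrix (Fin d) (Fin d) ℂ := Matrix.of e
  have h1 : U.map star * Uᵀ = 1 := by
    ext k l
    simpa [U, Matrix.mul_apply, Matrix.one_apply] using he k l
  have h1' : Uᵀ * U.map star = 1 := mul_eq_one_comm.1 h1
  have h2 := congrFun (congrFun h1' b) a
  simp only [U, Matrix.mul_apply, Matrix.one_apply, Matrix.transpose_apply, Matrix.map_apply,
    Matrix.of_apply] at h2
  simp only [mul_comm (star _)]
  rw [h2]
  simp [eq_comm]

lemma condOp_trace_sum {d₁ d₂ : ℕ} (ρ : Matrix (Fin d₁ × Fin d₂) (Fin d₁ × Fin d₂) ℂ)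
    {e : Fin d₂ → Fin d₂ → ℂ} (he : IsON e) :
    ∑ k, (condOp ρ (e k)).trace = ρ.trace := by
  simp only [Matrix.trace, condOp, Matrix.diag_apply, Matrix.of_apply, Fintype.sum_prod_type]
  rw [Finset.sum_comm]
  refine Finset.sum_congr rfl fun i _ => ?_
  rw [Finset.sum_comm]
  refine Finset.sum_congr rfl fun a _ => ?_
  rw [Finset.sum_comm]
  simp only [← Finset.sum_mul, he.complete]
  simp

lemma condOp_kron_pure {d₁ d₂ : ℕ} (R : Matrix (Fin d₁) (Fin d₁) ℂ) (φ ψ : Fin d₂ → ℂ) :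
    condOp (R ⊗ₖ pureState φ) ψ
      = ((∑ i, star (ψ i) * φ i) * (∑ i, star (φ i) * ψ i)) • R := by
  ext i i'
  simp only [condOp, pureState, Matrix.of_apply, Matrix.kroneckerMap_apply,
    Matrix.vecMulVec_apply, Matrix.smul_apply, smul_eq_mul, Pi.star_apply]
  rw [Finset.sum_mul_sum]
  simp only [Finset.sum_mul]
  refine Finset.sum_congr rfl fun a _ => Finset.sum_congr rfl fun b _ => ?_
  ring

lemma Dg_le_basis {d₁ d₂ : ℕ} (hd₁ : 2 ≤ d₁)
    {ρ : Matrix (Fin d₁ × Fin d₂) (Fin d₁ × Fin d₂) ℂ} (hρ : IsState ρ)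
    {e : Fin d₂ → Fin d₂ → ℂ} (he : IsON e) :
    Dg ρ ≤ ((ρ * ρ).trace).re - (∑ k, (condOp ρ (e k) * condOp ρ (e k)).trace).re := by
  have hR := fun k => condOp_posSemidef hρ.1 (e k)
  choose σ hσ hσR using fun k => posSemidef_normalize hd₁ (hR k)
  let χ : Matrix (Fin d₁ × Fin d₂) (Fin d₁ × Fin d₂) ℂ :=
    ∑ k, (condOp ρ (e k)) ⊗ₖ pureState (e k)
  have hχ : IsQCState χ := by
    refine ⟨fun k => (condOp ρ (e k)).trace.re, σ, e, fun k => (posSemidef_trace_real (hR k)).1,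
      ?_, hσ, he, ?_⟩
    · rw [← Complex.re_sum, condOp_trace_sum ρ he, hρ.2, Complex.one_re]
    · refine Finset.sum_congr rfl fun k _ => ?_
      rw [← Matrix.smul_kronecker, hσR]
  have hb : BddBelow {x : ℝ | ∃ χ, IsQCState χ ∧ x = (((ρ - χ) * (ρ - χ)).trace).re} := by
    refine ⟨0, ?_⟩
    rintro x ⟨χ', hχ', rfl⟩
    exact herm_sq_trace_nonneg (hρ.1.1.sub (qc_herm hχ'))
  have h1 : (ρ * χ).trace = ∑ k, (condOp ρ (e k) * condOp ρ (e k)).trace := by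
    simp only [χ, Matrix.mul_sum, Matrix.trace_sum, trace_mul_kron_pure]
  have h2 : (χ * χ).trace = ∑ k, (condOp ρ (e k) * condOp ρ (e k)).trace := by
    have : ∀ k l, (((condOp ρ (e k)) ⊗ₖ pureState (e k)) *
        ((condOp ρ (e l)) ⊗ₖ pureState (e l))).trace
        = if k = l then (condOp ρ (e k) * condOp ρ (e k)).trace else 0 := by
      intro k l
      rw [trace_mul_kron_pure, condOp_kron_pure, he k l, he l k]
      by_cases h : k = l
      · subst h; simp
      · simp [h]
    simp only [χ, Matrix.sum_mul, Matrix.mul_sum, Matrix.trace_sum, this]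
    simp
  refine (csInf_le hb ⟨χ, hχ, rfl⟩).trans (le_of_eq ?_)
  rw [sub_mul, mul_sub, mul_sub, Matrix.trace_sub, Matrix.trace_sub, Matrix.trace_sub,
    Matrix.trace_mul_comm χ ρ, h1, h2]
  simp only [Complex.sub_re]
  ring

/-- The quartic coefficients. -/
def quartic {d₁ d₂ : ℕ} (ρ : Matrix (Fin d₁ × Fin d₂) (Fin d₁ × Fin d₂) ℂ) (a b c d : Fin d₂) : ℂ :=
  ∑ i, ∑ i', ρ (i, a) (i', b) * ρ (i', c) (i, d)

lemma condOp_sq_trace {d₁ d₂ : ℕ} (ρ : Matrix (Fin d₁ × Fin d₂) (Fin d₁ × Fin d₂) ℂ)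
    (ψ : Fin d₂ → ℂ) :
    (condOp ρ ψ * condOp ρ ψ).trace
      = ∑ a, ∑ b, ∑ c, ∑ d, (star (ψ a) * ψ b * star (ψ c) * ψ d) * quartic ρ a b c d := by
  have : condOp ρ ψ = ∑ a, ∑ b, (star (ψ a) * ψ b) • Matrix.of fun i i' => ρ (i, a) (i', b) := by
    ext i i'
    simp [condOp, Matrix.sum_apply]
  rw [this]
  simp only [Matrix.sum_mul, Matrix.mul_sum, Matrix.trace_sum, Matrix.smul_mul, Matrix.mul_smul,
    Matrix.trace_smul, smul_eq_mul]
  simp only [Finset.mul_sum]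
  refine Finset.sum_congr rfl fun a _ => Finset.sum_congr rfl fun b _ =>
    Finset.sum_congr rfl fun c _ => Finset.sum_congr rfl fun d _ => ?_
  rw [Matrix.trace_mul_comm]
  simp only [quartic, Matrix.trace, Matrix.diag_apply, Matrix.mul_apply, Matrix.of_apply]
  ring

lemma phase_sum {n : ℕ} (a b c d : Fin n) :
    ∑ s : Fin n → ZMod 3, (star (ZMod.stdAddChar (s a) : ℂ) * ZMod.stdAddChar (s b) *
      star (ZMod.stdAddChar (s c) : ℂ) * ZMod.stdAddChar (s d))
      = if (a = b ∧ c = d) ∨ (a = d ∧ c = b) then (Fintype.card (Fin n → ZMod 3) : ℂ) else 0 := by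
  have hstar : ∀ x : ZMod 3, star (ZMod.stdAddChar x : ℂ) = ZMod.stdAddChar (-x) :=
    fun x => (AddChar.map_neg_eq_conj _ x).symm
  simp only [hstar, ← AddChar.map_add_eq_mul]
  split_ifs with h
  · rcases h with ⟨rfl, rfl⟩ | ⟨rfl, rfl⟩
    · simp [AddChar.map_zero_eq_one]
    · have : ∀ s : Fin n → ZMod 3, -s a + s c + -s c + s a = 0 := fun s => by ring
      simp [this, AddChar.map_zero_eq_one]
  · set L : (Fin n → ZMod 3) → ZMod 3 := fun s => -s a + s b + -s c + s d with hL
    have key : ∃ j, L (Pi.single j 1) ≠ 0 := by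
      have t1 : (1 : ZMod 3) ≠ 0 := by decide
      have t2 : (-1 : ZMod 3) ≠ 0 := by decide
      have t3 : (-1 + -1 : ZMod 3) ≠ 0 := by decide
      have t4 : (1 + 1 : ZMod 3) ≠ 0 := by decide
      have t5 : (-1 + 1 + -1 : ZMod 3) ≠ 0 := by decide
      simp only [hL, Pi.single_apply]
      by_cases h1 : a = b
      · subst h1
        refine ⟨c, ?_⟩
        have hcd : ¬ d = c := fun hh => h (Or.inl ⟨rfl, hh.symm⟩)
        simp [hcd]
      · by_cases h2 : a = d
        · subst h2
          refine ⟨c, ?_⟩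
          have hcb : ¬ b = c := fun hh => h (Or.inr ⟨rfl, hh.symm⟩)
          simp [hcb]
        · refine ⟨a, ?_⟩
          have h1' : ¬ b = a := fun hh => h1 hh.symm
          have h2' : ¬ d = a := fun hh => h2 hh.symm
          by_cases h3 : c = a
          · simpa [h1', h2', h3] using t3
          · simp [h1', h2', h3]
    obtain ⟨j, hj⟩ := key
    have hadd : ∀ s, L (s + Pi.single j 1) = L s + L (Pi.single j 1) := by
      intro s; simp only [hL, Pi.add_apply]; ring
    have e := Equiv.sum_comp (Equiv.addRight (Pi.single j (1 : ZMod 3) : Fin n → ZMod 3))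
      (fun s => (ZMod.stdAddChar (L s) : ℂ))
    simp only [Equiv.coe_addRight, hadd, AddChar.map_add_eq_mul, ← Finset.sum_mul] at e
    have hne : (ZMod.stdAddChar (L (Pi.single j 1)) : ℂ) ≠ 1 := by
      intro hh
      apply hj
      apply ZMod.injective_stdAddChar (N := 3)
      rw [hh, AddChar.map_zero_eq_one]
    have e2 : (∑ s, (ZMod.stdAddChar (L s) : ℂ)) * ((ZMod.stdAddChar (L (Pi.single j 1)) : ℂ) - 1) = 0 := by
      rw [mul_sub, mul_one, sub_eq_zero]; exact e
    rcases mul_eq_zero.1 e2 with h0 | h0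
    · exact h0
    · exact absurd (sub_eq_zero.1 h0) hne

/-- The Fourier basis exists: a flat orthonormal basis. -/
lemma exists_flat {n : ℕ} (hn : n ≠ 0) : ∃ F : Fin n → Fin n → ℂ, IsON F ∧
    ∀ k a, star (F k a) * F k a = 1 / (n : ℂ) := by
  haveI : NeZero n := ⟨hn⟩
  have hn0 : (n : ℂ) ≠ 0 := by exact_mod_cast hn
  have hs : (1 / (Real.sqrt n : ℂ)) * (1 / (Real.sqrt n : ℂ)) = 1 / (n : ℂ) := by
    rw [div_mul_div_comm, ← Complex.ofReal_mul, Real.mul_self_sqrt (by positivity)]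
    simp
  let ζ : AddChar (ZMod n) ℂ := ZMod.stdAddChar
  have hstar : ∀ x : ZMod n, star (ζ x) = ζ (-x) := fun x => (AddChar.map_neg_eq_conj _ x).symm
  have hmul : ∀ (k l i : Fin n), star ((1 / (Real.sqrt n : ℂ)) * ζ ((k : ℕ) * (i : ℕ) : ZMod n)) *
      ((1 / (Real.sqrt n : ℂ)) * ζ ((l : ℕ) * (i : ℕ) : ZMod n))
      = 1 / (n : ℂ) * (ζ (((l : ℕ) : ZMod n) - ((k : ℕ) : ZMod n))) ^ (i : ℕ) := by
    intro k l i
    rw [star_mul', hstar, ← AddChar.map_nsmul_eq_pow, ← hs]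
    have : ((i : ℕ) • (((l : ℕ) : ZMod n) - ((k : ℕ) : ZMod n)))
       = -((k : ℕ) * (i : ℕ) : ZMod n) + ((l : ℕ) * (i : ℕ) : ZMod n) := by
      rw [nsmul_eq_mul]; ring
    rw [this, AddChar.map_add_eq_mul]
    simp
    ring
  refine ⟨fun k a => (1 / (Real.sqrt n : ℂ)) * ζ ((k : ℕ) * (a : ℕ) : ZMod n), ?_, ?_⟩
  · intro k l
    simp only [hmul, ← Finset.mul_sum]
    split_ifs with h
    · subst h
      simp [AddChar.map_zero_eq_one, hn0]
    · set w := ζ (((l : ℕ) : ZMod n) - ((k : ℕ) : ZMod n)) with hw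
      have hw1 : w ≠ 1 := by
        intro hh
        have : ((l : ℕ) : ZMod n) - ((k : ℕ) : ZMod n) = 0 := by
          apply ZMod.injective_stdAddChar (N := n)
          rw [AddChar.map_zero_eq_one]; exact hh
        rw [sub_eq_zero, ZMod.natCast_eq_natCast_iff'] at this
        rw [Nat.mod_eq_of_lt l.2, Nat.mod_eq_of_lt k.2] at this
        exact h (Fin.ext this.symm)
      have hwn : w ^ n = 1 := by
        rw [hw, ← AddChar.map_nsmul_eq_pow]
        simp [AddChar.map_zero_eq_one]
      rw [Fin.sum_univ_eq_sum_range (fun i => w ^ i) n, geom_sum_eq hw1, hwn]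
      simp
  · intro k a
    rw [hmul]
    simp [AddChar.map_zero_eq_one]

lemma phase_avg {d₁ n : ℕ} (ρ : Matrix (Fin d₁ × Fin n) (Fin d₁ × Fin n) ℂ)
    (f : Fin n → ℂ) (hf : ∀ a, star (f a) * f a = 1 / (n : ℂ)) :
    ∑ s : Fin n → ZMod 3, (condOp ρ (fun a => ZMod.stdAddChar (s a) * f a) *
        condOp ρ (fun a => ZMod.stdAddChar (s a) * f a)).trace
      = (Fintype.card (Fin n → ZMod 3) : ℂ) * ((1 / (n : ℂ)) ^ 2 *
        (∑ a, ∑ c, quartic ρ a a c c + ∑ a, ∑ b, quartic ρ a b b a - ∑ a, quartic ρ a a a a)) := by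
  simp only [condOp_sq_trace]
  have e1 : ∀ a b c d, ∑ s : Fin n → ZMod 3,
      (star ((ZMod.stdAddChar (s a) : ℂ) * f a) * (ZMod.stdAddChar (s b) * f b) *
      star ((ZMod.stdAddChar (s c) : ℂ) * f c) * (ZMod.stdAddChar (s d) * f d)) * quartic ρ a b c d
      = (Fintype.card (Fin n → ZMod 3) : ℂ) * ((1 / (n : ℂ)) ^ 2 *
        ((if b = a then if d = c then quartic ρ a b c d else 0 else 0)
         + (if d = a then if c = b then quartic ρ a b c d else 0 else 0)
         - (if b = a then if c = a then if d = a then quartic ρ a b c d else 0 else 0 else 0))) := by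
    intro a b c d
    have : ∀ s : Fin n → ZMod 3, 
      (star ((ZMod.stdAddChar (s a) : ℂ) * f a) * (ZMod.stdAddChar (s b) * f b) *
      star ((ZMod.stdAddChar (s c) : ℂ) * f c) * (ZMod.stdAddChar (s d) * f d)) * quartic ρ a b c d
      = (star (ZMod.stdAddChar (s a) : ℂ) * ZMod.stdAddChar (s b) *
      star (ZMod.stdAddChar (s c) : ℂ) * ZMod.stdAddChar (s d)) *
        (star (f a) * f b * star (f c) * f d * quartic ρ a b c d) := by
      intro s
      simp only [star_mul']
      ring
    simp only [this, ← Finset.sum_mul, phase_sum]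
    by_cases h1 : a = b ∧ c = d
    · obtain ⟨rfl, rfl⟩ := h1
      have hq : star (f a) * f a * star (f c) * f c = (1 / (n : ℂ)) ^ 2 := by
        rw [mul_assoc _ (star (f c)), hf, hf]; ring
      rw [hq]
      by_cases hac : c = a
      · subst hac; simp
      · simp [hac]
    · by_cases h2 : a = d ∧ c = b
      · obtain ⟨rfl, rfl⟩ := h2
        have hq : star (f a) * f c * star (f c) * f a = (1 / (n : ℂ)) ^ 2 := by
          rw [pow_two]
          nth_rewrite 1 [← hf a]
          rw [← hf c]; ring
        rw [hq]
        have hac : ¬ c = a := fun hh => h1 ⟨hh.symm, hh⟩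
        simp [hac]
      · rw [if_neg (by tauto)]
        have t1 : ¬ (b = a ∧ d = c) := fun hh => h1 ⟨hh.1.symm, hh.2.symm⟩
        have t2 : ¬ (d = a ∧ c = b) := fun hh => h2 ⟨hh.1.symm, hh.2⟩
        have t3 : ¬ (b = a ∧ c = a ∧ d = a) := fun hh => t1 ⟨hh.1, by rw [hh.2.1, hh.2.2]⟩
        simp only [← ite_and, if_neg t1, if_neg t2]
        rw [if_neg (by tauto)]
        simp
  rw [Finset.sum_comm]
  simp only [Finset.sum_comm (s := (Finset.univ : Finset (Fin n → ZMod 3)))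
    (t := (Finset.univ : Finset (Fin n))), e1, ← Finset.mul_sum]
  congr 2
  simp only [Finset.sum_sub_distrib, Finset.sum_add_distrib]
  congr 1
  · congr 1
    · simp only [Finset.sum_ite_irrel, Finset.sum_const_zero]
      simp
    · simp
  · simp only [Finset.sum_ite_irrel, Finset.sum_const_zero]
    simp

lemma quartic_X {d₁ d₂ : ℕ} (ρ : Matrix (Fin d₁ × Fin d₂) (Fin d₁ × Fin d₂) ℂ) :
    ∑ a, ∑ c, quartic ρ a a c c = (ptrace2 ρ * ptrace2 ρ).trace := by
  simp only [quartic, Matrix.trace, Matrix.mul_apply, Matrix.diag_apply, ptrace2, Matrix.of_apply,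
    Finset.sum_mul_sum]
  simp only [Finset.sum_comm (s := (Finset.univ : Finset (Fin d₂)))
    (t := (Finset.univ : Finset (Fin d₁)))]

lemma quartic_Y {d₁ d₂ : ℕ} (ρ : Matrix (Fin d₁ × Fin d₂) (Fin d₁ × Fin d₂) ℂ) :
    ∑ a, ∑ b, quartic ρ a b b a = (ρ * ρ).trace := by
  simp only [quartic, Matrix.trace, Matrix.mul_apply, Matrix.diag_apply, Fintype.sum_prod_type]
  simp only [Finset.sum_comm (s := (Finset.univ : Finset (Fin d₂)))
    (t := (Finset.univ : Finset (Fin d₁)))]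

lemma avg_bound {d₁ d₂ : ℕ} (hd : 2 ≤ d₂)
    (ρ : Matrix (Fin d₁ × Fin d₂) (Fin d₁ × Fin d₂) ℂ) (K : ℝ)
    (hK : ∀ e, IsON e → (∑ k, (condOp ρ (e k) * condOp ρ (e k)).trace).re ≤ K) :
    ((ptrace2 ρ * ptrace2 ρ).trace).re + ((ρ * ρ).trace).re ≤ (d₂ + 1) * K := by
  have hd0 : d₂ ≠ 0 := by omega
  have hdc : (d₂ : ℂ) ≠ 0 := by exact_mod_cast hd0
  have hdp : (0 : ℝ) < d₂ := by exact_mod_cast (by omega : 0 < d₂)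
  obtain ⟨F, hF, hflat⟩ := exists_flat hd0
  set S0 : ℂ := ∑ a, quartic ρ a a a a with hS0
  have h1 : S0.re ≤ K := by
    have := hK (fun k i => if i = k then 1 else 0) (by
      intro k l
      simp [apply_ite star, eq_comm])
    refine le_trans (le_of_eq ?_) this
    congr 1
    refine Finset.sum_congr rfl fun k _ => ?_
    rw [condOp_sq_trace]
    simp [apply_ite star]
  have h2 : ∀ s : Fin d₂ → ZMod 3, (∑ k, (condOp ρ (fun a => ZMod.stdAddChar (s a) * F k a) *
        condOp ρ (fun a => ZMod.stdAddChar (s a) * F k a)).trace).re ≤ K := by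
    intro s
    apply hK (fun k a => ZMod.stdAddChar (s a) * F k a)
    intro k l
    rw [← hF k l]
    refine Finset.sum_congr rfl fun i _ => ?_
    have hz : star (ZMod.stdAddChar (s i) : ℂ) * ZMod.stdAddChar (s i) = 1 := by
      have : star (ZMod.stdAddChar (s i) : ℂ) = ZMod.stdAddChar (-(s i)) :=
        (AddChar.map_neg_eq_conj _ _).symm
      rw [this, ← AddChar.map_add_eq_mul]
      simp [AddChar.map_zero_eq_one]
    rw [star_mul']
    linear_combination (star (F k i) * F l i) * hz
  have h3 := Finset.sum_le_sum fun s (_ : s ∈ (Finset.univ : Finset (Fin d₂ → ZMod 3))) => h2 s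
  rw [← Complex.re_sum, Finset.sum_comm, Finset.sum_congr rfl fun k _ => phase_avg ρ (F k) (hflat k),
    quartic_X, quartic_Y, ← hS0] at h3
  simp only [Finset.sum_const, Finset.card_univ, Fintype.card_fin, nsmul_eq_mul] at h3
  set N : ℕ := Fintype.card (Fin d₂ → ZMod 3) with hN
  have hNp : (0 : ℝ) < N := by exact_mod_cast Fintype.card_pos
  have e : (d₂ : ℂ) * ((N : ℂ) * ((1 / (d₂ : ℂ)) ^ 2 *
      ((ptrace2 ρ * ptrace2 ρ).trace + (ρ * ρ).trace - S0)))
      = (((N : ℝ) / d₂ : ℝ) : ℂ) * ((ptrace2 ρ * ptrace2 ρ).trace + (ρ * ρ).trace - S0) := by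
    push_cast
    field_simp
  rw [e, Complex.re_ofReal_mul, Complex.sub_re, Complex.add_re, div_mul_eq_mul_div,
    div_le_iff₀ hdp, mul_assoc] at h3
  have h4 := le_of_mul_le_mul_left h3 hNp
  linarith
/-- for an arbitrary two-qudit state `ρ` on `ℂ^{d₁}⊗ℂ^{d₂}`,
`D_g(ρ) ≤ ((d₂-1)/d₂)(1 - ‖r₂‖²/(d₂+1)) ≤ (d₂-1)/d₂`. -/
theorem stmt8 {d₁ d₂ : ℕ} (hd₁ : 2 ≤ d₁) (hd₂ : 2 ≤ d₂)
    (ρ : Matrix (Fin d₁ × Fin d₂) (Fin d₁ × Fin d₂) ℂ) (hρ : IsState ρ)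
    (Υ₂ : Fin (d₂ ^ 2 - 1) → Matrix (Fin d₂) (Fin d₂) ℂ) (hΥ₂ : IsBlochBasis d₂ Υ₂) :
    Dg ρ ≤ (((d₂ : ℝ) - 1) / d₂) *
        (1 - (∑ i, blochVector (ptrace1 ρ) Υ₂ i ^ 2) / ((d₂ : ℝ) + 1)) ∧
    (((d₂ : ℝ) - 1) / d₂) *
        (1 - (∑ i, blochVector (ptrace1 ρ) Υ₂ i ^ 2) / ((d₂ : ℝ) + 1))
      ≤ ((d₂ : ℝ) - 1) / d₂ := by
  have hdp : (2 : ℝ) ≤ d₂ := by exact_mod_cast hd₂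
  set r2 := ∑ i, blochVector (ptrace1 ρ) Υ₂ i ^ 2 with hr2
  have hr0 : 0 ≤ r2 := Finset.sum_nonneg fun i _ => sq_nonneg _
  have hfac : 0 ≤ ((d₂ : ℝ) - 1) / d₂ := div_nonneg (by linarith) (by linarith)
  refine ⟨?_, ?_⟩
  · have hherm : (ptrace1 ρ).IsHermitian := by
      ext a b
      simp only [ptrace1, Matrix.conjTranspose_apply, Matrix.of_apply, star_sum]
      exact Finset.sum_congr rfl fun i _ => hρ.1.1.apply _ _
    have htr : (ptrace1 ρ).trace = 1 := by
      rw [← hρ.2]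
      simp only [ptrace1, Matrix.trace, Matrix.diag_apply, Matrix.of_apply, Fintype.sum_prod_type]
      rw [Finset.sum_comm]
    have hB := bessel hd₂ hherm htr hΥ₂
    have hr : r2 = ((d₂ : ℝ) / (2 * ((d₂ : ℝ) - 1))) *
        ∑ k, (((ptrace1 ρ * Υ₂ k).trace).re) ^ 2 := by
      rw [hr2, Finset.mul_sum]
      refine Finset.sum_congr rfl fun k _ => ?_
      rw [blochVector, mul_pow, Real.sq_sqrt]
      exact div_nonneg (by linarith) (by linarith)
    have hav := avg_bound hd₂ ρ (((ρ * ρ).trace).re - Dg ρ) (fun e he => by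
      have := Dg_le_basis hd₁ hρ he
      linarith)
    have hp1 := purity_le_one hρ
    have hp2 := purity_ineq hρ
    set P := ((ρ * ρ).trace).re
    set P1 := ((ptrace2 ρ * ptrace2 ρ).trace).re
    set P2 := ((ptrace1 ρ * ptrace1 ρ).trace).re
    have hr' : r2 ≤ ((d₂ : ℝ) / ((d₂ : ℝ) - 1)) * (P2 - 1 / d₂) := by
      rw [hr]
      refine (mul_le_mul_of_nonneg_left hB (div_nonneg (by linarith) (by linarith))).trans
        (le_of_eq ?_)
      have : (d₂ : ℝ) - 1 ≠ 0 := by linarith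
      field_simp
    have hstep : (((d₂ : ℝ) - 1) / d₂) *
        (1 - (((d₂ : ℝ) / ((d₂ : ℝ) - 1)) * (P2 - 1 / d₂)) / ((d₂ : ℝ) + 1))
        = (d₂ - P2) / (d₂ + 1) := by
      have h1 : (d₂ : ℝ) - 1 ≠ 0 := by linarith
      have h2 : (d₂ : ℝ) ≠ 0 := by linarith
      have h3 : (d₂ : ℝ) + 1 ≠ 0 := by linarith
      field_simp
      ring
    have hmono : (d₂ - P2) / (d₂ + 1) ≤ (((d₂ : ℝ) - 1) / d₂) * (1 - r2 / ((d₂ : ℝ) + 1)) := by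
      rw [← hstep]
      refine mul_le_mul_of_nonneg_left ?_ hfac
      have := div_le_div_of_nonneg_right hr' (by linarith : (0 : ℝ) ≤ (d₂ : ℝ) + 1)
      linarith
    refine le_trans ?_ hmono
    rw [le_div_iff₀ (by linarith)]
    nlinarith [mul_nonneg (by linarith : (0 : ℝ) ≤ (d₂ : ℝ) - 1) (by linarith : 0 ≤ 1 - P)]
  · have h : 0 ≤ r2 / ((d₂ : ℝ) + 1) := div_nonneg hr0 (by linarith)
    nlinarith
end
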